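/- arXiv:1410.8345 — 2 statements merged into one kernel-verified Lean document; each statement's English description precedes it below -/
import Mathlib

section
/- (Lemma 2.3.) Let N ≥ 2, λ > 0, ρ > 0, and let g : ℝ → ℝ be a bounded locally Lipschitz function with primitive G(u) := ∫₀ᵘ g(s) ds. Let K_ρ denote the set of functions v : [0,ρ] → ℝ that are Lipschitz with constant 1 and satisfy v(ρ) = 0, and for v ∈ K_ρ set J(v) := ∫₀^ρ r^{N−1}(1−√(1−v'(r)²)) dr − λ∫₀^ρ r^{N−1} G(v(r)) dr (v' exists almost everywhere by Rademacher's theorem). If v₀ ∈ K_ρ is a local minimum of J on K_ρ with respect to the supremum norm, then v₀ ∈ C²([0,ρ]), |v₀'(r)| < 1 for all r ∈ [0,ρ], v₀'(0) = 0, v₀(ρ) = 0, and (v₀'(r)/√(1−v₀'(r)²))' + ((N−1)/r)·v₀'(r)/√(1−v₀'(r)²) + λ·g(v₀(r)) = 0 for all r ∈ (0,ρ); that is, x ↦ v₀(|x|) is a classical solution of the Dirichlet problem ∇·[∇u/√(1−|∇u|²)] + λg(u) = 0 in B_ρ, u = 0 on ∂B_ρ. -/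
open Set Filter

/-- Membership in `K_ρ`: 1-Lipschitz on `[0,ρ]` with `v(ρ) = 0`. -/
def MemK (ρ : ℝ) (v : ℝ → ℝ) : Prop :=
  LipschitzOnWith 1 v (Set.Icc 0 ρ) ∧ v ρ = 0

/-- The action functional
`J(v) = ∫₀^ρ r^{N-1}(1 - √(1 - v'(r)²)) dr - λ ∫₀^ρ r^{N-1} G(v(r)) dr`
(the derivative `deriv v` exists a.e. for `v ∈ K_ρ` by Rademacher's theorem). -/
noncomputable def Jfunc (N : ℕ) (lam ρ : ℝ) (G : ℝ → ℝ) (v : ℝ → ℝ) : ℝ :=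
  (∫ r in (0:ℝ)..ρ, r ^ (N - 1) * (1 - Real.sqrt (1 - (deriv v r) ^ 2))) -
    lam * ∫ r in (0:ℝ)..ρ, r ^ (N - 1) * G (v r)

open MeasureTheory Topology in
lemma aux_p (n : ℕ) (hn : 1 ≤ n) (h : ℝ → ℝ) (hc : Continuous h) :
    ∃ p : ℝ → ℝ, p 0 = 0 ∧ ContDiff ℝ 1 p ∧
      (∀ r, r ^ n * p r = ∫ s in (0:ℝ)..r, s ^ n * h s) ∧
      ∀ r, r ≠ 0 → HasDerivAt p (h r - n / r * p r) r := by
  set k : ℝ → ℝ := fun r => ∫ σ in (0:ℝ)..1, σ ^ n * h (r * σ) with hk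
  have hkc : Continuous k := by
    apply intervalIntegral.continuous_parametric_intervalIntegral_of_continuous'
    simp only [Function.uncurry_def]
    fun_prop
  have hH : ∀ r, r ^ n * (r * k r) = ∫ s in (0:ℝ)..r, s ^ n * h s := by
    intro r
    have := intervalIntegral.mul_integral_comp_mul_left (a := 0) (b := 1)
      (f := fun s => s ^ n * h s) (c := r)
    simp only [mul_zero, mul_one] at this
    rw [← this, hk]
    simp only [mul_pow, mul_assoc, intervalIntegral.integral_const_mul]
    ring
  have hHd : ∀ r, HasDerivAt (fun r => ∫ s in (0:ℝ)..r, s ^ n * h s) (r ^ n * h r) r := by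
    intro r
    have : Continuous (fun s => s ^ n * h s) := by fun_prop
    exact this.integral_hasStrictDerivAt 0 r |>.hasDerivAt
  have hd : ∀ r, r ≠ 0 → HasDerivAt (fun r => r * k r) (h r - n * k r) r := by
    intro r hr
    have h1 := (hHd r).div (hasDerivAt_pow n r) (pow_ne_zero n hr)
    have h2 : HasDerivAt (fun r => r * k r) ((r ^ n * h r * r ^ n -
      (∫ s in (0:ℝ)..r, s ^ n * h s) * (n * r ^ (n - 1))) / (r ^ n) ^ 2) r := by
      refine h1.congr_of_eventuallyEq ?_
      filter_upwards [isOpen_ne.mem_nhds hr] with x hx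
      have : x ^ n ≠ 0 := pow_ne_zero n hx
      simp only [Pi.div_apply]
      rw [← hH x]; field_simp
    convert h2 using 1
    rw [← hH r]
    obtain ⟨m, rfl⟩ : ∃ m, n = m + 1 := ⟨n - 1, by omega⟩
    simp only [Nat.add_sub_cancel]
    field_simp
    ring
  have hk0 : k 0 = h 0 - n * k 0 := by
    have : k 0 = h 0 / (n + 1) := by
      simp [hk, intervalIntegral.integral_mul_const, integral_pow]
      ring
    rw [this]
    have : (n:ℝ) + 1 ≠ 0 := by positivity
    field_simp
    ring
  have hd' : ∀ r, HasDerivAt (fun r => r * k r) (h r - n * k r) r := by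
    intro r
    by_cases hr : r = 0
    · subst hr
      rw [← hk0, hasDerivAt_iff_tendsto_slope]
      have : Tendsto k (𝓝[≠] 0) (𝓝 (k 0)) := hkc.continuousAt.tendsto.mono_left nhdsWithin_le_nhds
      refine this.congr' ?_
      filter_upwards [self_mem_nhdsWithin] with x hx
      have hx : x ≠ 0 := hx
      simp [slope_def_field]
      field_simp
    · exact hd r hr
  refine ⟨fun r => r * k r, by simp, ?_, hH, ?_⟩
  · rw [contDiff_one_iff_deriv]
    refine ⟨fun r => (hd' r).differentiableAt, ?_⟩
    rw [show deriv (fun r => r * k r) = fun r => h r - n * k r from funext fun r => (hd' r).deriv]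
    fun_prop
  · intro r hr
    convert hd r hr using 1
    field_simp

lemma aux_deficit (p q : ℝ) (hq : |q| ≤ 1) :
    let w := -p / √(1 + p ^ 2)
    (1 - √(1 - w ^ 2)) - p * (q - w) + (q - w) ^ 2 / 2 ≤ 1 - √(1 - q ^ 2) := by
  intro w
  set c := √(1 + p ^ 2) with hc
  have hc2 : c ^ 2 = 1 + p ^ 2 := Real.sq_sqrt (by positivity)
  have hc1 : 1 ≤ c := by rw [hc, Real.one_le_sqrt]; nlinarith [sq_nonneg p]
  have hc0 : 0 < c := by linarith
  have hw : w = -p / c := rfl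
  have hpw : p = -w * c := by rw [hw]; field_simp
  have h1 : 1 - w ^ 2 = (1 / c) ^ 2 := by
    rw [hw]; field_simp; linarith
  have h2 : √(1 - w ^ 2) = 1 / c := by rw [h1, Real.sqrt_sq (by positivity)]
  set b := √(1 - q ^ 2) with hb
  have hq2 : q ^ 2 ≤ 1 := by rw [← sq_abs]; nlinarith [abs_nonneg q]
  have hb2 : b ^ 2 = 1 - q ^ 2 := Real.sq_sqrt (by linarith)
  rw [h2]
  set a := 1 / c with ha
  have hca : c * a = 1 := by rw [ha]; field_simp
  -- key: c * (1 - w q - a b) = deficit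
  have key : 1 - w * q - a * b = ((w - q) ^ 2 + (a - b) ^ 2) / 2 := by nlinarith
  have key2 : a - b - (q - w) * (w * c) = c * (1 - w * q - a * b) := by
    have : a = c * a ^ 2 := by rw [pow_two, ← mul_assoc, hca, one_mul]
    have e2 : a ^ 2 = 1 - w ^ 2 := h1.symm
    have e3 : c * a * b = b := by rw [hca, one_mul]
    calc a - b - (q - w) * (w * c) = c * (1 - w ^ 2) - c * a * b - (q - w) * (w * c) := by
          rw [e3, ← e2, ← this]
      _ = _ := by ring
  have key3 : (q - w) ^ 2 / 2 ≤ c * (1 - w * q - a * b) := by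
    rw [key]
    nlinarith [sq_nonneg (w - q), sq_nonneg (a - b), mul_nonneg (sub_nonneg.2 hc1) (add_nonneg (sq_nonneg (w-q)) (sq_nonneg (a-b)))]
  rw [hpw]
  linarith

lemma aux_convex (p q t : ℝ) (hp : |p| ≤ 1) (hq : |q| ≤ 1) (ht0 : 0 ≤ t) (ht1 : t ≤ 1) :
    1 - √(1 - (p + t * (q - p)) ^ 2) ≤
      (1 - √(1 - p ^ 2)) + t * ((1 - √(1 - q ^ 2)) - (1 - √(1 - p ^ 2))) := by
  have hp2 : p ^ 2 ≤ 1 := by rw [← sq_abs]; nlinarith [abs_nonneg p]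
  have hq2 : q ^ 2 ≤ 1 := by rw [← sq_abs]; nlinarith [abs_nonneg q]
  set a := √(1 - p ^ 2) with ha
  set b := √(1 - q ^ 2) with hb
  have ha2 : a ^ 2 = 1 - p ^ 2 := Real.sq_sqrt (by linarith)
  have hb2 : b ^ 2 = 1 - q ^ 2 := Real.sq_sqrt (by linarith)
  have : a + t * (b - a) ≤ √(1 - (p + t * (q - p)) ^ 2) := by
    apply Real.le_sqrt_of_sq_le
    have h1 : 0 ≤ t * (1 - t) := mul_nonneg ht0 (by linarith)
    nlinarith [mul_nonneg h1 (add_nonneg (sq_nonneg (p - q)) (sq_nonneg (a - b)))]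
  linarith

open MeasureTheory in
lemma aux_int (F : ℝ → ℝ) (hF : Measurable F) (ρ : ℝ) (hρ : 0 ≤ ρ) (C : ℝ)
    (hC : ∀ r ∈ Set.Ioo 0 ρ, |F r| ≤ C) : IntervalIntegrable F volume 0 ρ := by
  rw [intervalIntegrable_iff_integrableOn_Ioo_of_le hρ]
  refine IntegrableOn.of_bound (by simp) hF.aestronglyMeasurable C ?_
  exact (ae_restrict_iff' measurableSet_Ioo).2 (Filter.Eventually.of_forall hC)

lemma aux_ac (ρ : ℝ) (hρ : 0 < ρ) (v : ℝ → ℝ) (hv : MemK ρ v) :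
    AbsolutelyContinuousOnInterval v 0 ρ := by
  refine LipschitzOnWith.absolutelyContinuousOnInterval (K := 1) ?_
  rw [Set.uIcc_of_le hρ.le]
  exact hv.1

lemma aux_deriv_le (ρ : ℝ) (v : ℝ → ℝ) (hv : MemK ρ v) (r : ℝ) (hr : r ∈ Set.Ioo 0 ρ) :
    |deriv v r| ≤ 1 := by
  have := norm_deriv_le_of_lipschitzOn (Icc_mem_nhds hr.1 hr.2) hv.1
  simpa using this

open MeasureTheory in
lemma aux_psi_int (n : ℕ) (ρ : ℝ) (hρ : 0 < ρ) (v : ℝ → ℝ) :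
    IntervalIntegrable (fun r => r ^ n * (1 - √(1 - (deriv v r) ^ 2))) volume 0 ρ := by
  have := measurable_deriv v
  refine aux_int _ (by fun_prop) ρ hρ.le (ρ ^ n) ?_
  intro r hr
  have h1 : 0 ≤ √(1 - (deriv v r) ^ 2) := Real.sqrt_nonneg _
  have h2 : √(1 - (deriv v r) ^ 2) ≤ 1 := by
    rw [Real.sqrt_le_iff]; constructor <;> nlinarith [sq_nonneg (deriv v r)]
  rw [abs_mul, abs_of_nonneg (pow_nonneg hr.1.le n), abs_of_nonneg (by linarith)]
  have h3 : r ^ n ≤ ρ ^ n := pow_le_pow_left₀ hr.1.le hr.2.le n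
  have h4 : 0 ≤ r ^ n := pow_nonneg hr.1.le n
  nlinarith

open MeasureTheory Topology in
lemma aux_variational (N : ℕ) (lam : ℝ) (hlam : 0 < lam) (ρ : ℝ) (hρ : 0 < ρ)
    (g : ℝ → ℝ) (hgb : ∃ M : ℝ, ∀ s, |g s| ≤ M) (hgc : Continuous g)
    (v₀ : ℝ → ℝ) (hv₀ : MemK ρ v₀)
    (hmin : ∃ ε > (0:ℝ), ∀ v : ℝ → ℝ, MemK ρ v →
      (∀ r ∈ Set.Icc (0:ℝ) ρ, |v r - v₀ r| < ε) →
      Jfunc N lam ρ (fun u => ∫ s in (0:ℝ)..u, g s) v₀ ≤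
        Jfunc N lam ρ (fun u => ∫ s in (0:ℝ)..u, g s) v) (w : ℝ → ℝ) (hw : MemK ρ w) :
    lam * (∫ r in (0:ℝ)..ρ, r ^ (N - 1) * (g (v₀ r) * (w r - v₀ r))) ≤
      (∫ r in (0:ℝ)..ρ, r ^ (N - 1) * (1 - √(1 - (deriv w r) ^ 2))) -
      ∫ r in (0:ℝ)..ρ, r ^ (N - 1) * (1 - √(1 - (deriv v₀ r) ^ 2)) := by
  obtain ⟨ε, hε, hmin⟩ := hmin
  obtain ⟨M, hM⟩ := hgb
  generalize hn : N - 1 = n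
  simp only [Jfunc, hn] at hmin
  set G : ℝ → ℝ := fun u => ∫ s in (0:ℝ)..u, g s with hG
  have hGd : ∀ u, HasDerivAt G (g u) u := fun u =>
    (hgc.integral_hasStrictDerivAt 0 u).hasDerivAt
  have hGc : Continuous G := continuous_iff_continuousAt.2 fun u => (hGd u).continuousAt
  have hvc : ContinuousOn v₀ (Set.Icc 0 ρ) := hv₀.1.continuousOn
  have hwc : ContinuousOn w (Set.Icc 0 ρ) := hw.1.continuousOn
  have huI : Set.uIoc 0 ρ ⊆ Set.Icc 0 ρ := by
    rw [Set.uIoc_of_le hρ.le]; exact Set.Ioc_subset_Icc_self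
  have huIcc : Set.uIcc 0 ρ = Set.Icc 0 ρ := Set.uIcc_of_le hρ.le
  have hFc : ∀ t : ℝ, ContinuousOn (fun r => r ^ n * G (v₀ r + t * (w r - v₀ r))) (Set.Icc 0 ρ) := by
    intro t
    have : ContinuousOn (fun r => v₀ r + t * (w r - v₀ r)) (Set.Icc 0 ρ) := by fun_prop
    exact (by fun_prop : ContinuousOn (fun r : ℝ => r ^ n) _).mul (hGc.comp_continuousOn this)
  have hF'c : ∀ t : ℝ, ContinuousOn
      (fun r => r ^ n * (g (v₀ r + t * (w r - v₀ r)) * (w r - v₀ r))) (Set.Icc 0 ρ) := by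
    intro t
    have : ContinuousOn (fun r => v₀ r + t * (w r - v₀ r)) (Set.Icc 0 ρ) := by fun_prop
    exact (by fun_prop : ContinuousOn (fun r : ℝ => r ^ n) _).mul
      ((hgc.comp_continuousOn this).mul (hwc.sub hvc))
  have hder : HasDerivAt (fun t : ℝ => ∫ r in (0:ℝ)..ρ, r ^ n * G (v₀ r + t * (w r - v₀ r)))
      (∫ r in (0:ℝ)..ρ, r ^ n * (g (v₀ r + 0 * (w r - v₀ r)) * (w r - v₀ r))) 0 := by
    refine (intervalIntegral.hasDerivAt_integral_of_dominated_loc_of_deriv_le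
      (F := fun t r => r ^ n * G (v₀ r + t * (w r - v₀ r)))
      (F' := fun t r => r ^ n * (g (v₀ r + t * (w r - v₀ r)) * (w r - v₀ r)))
      (s := Set.univ) (bound := fun r => |r ^ n| * (M * |w r - v₀ r|))
      Filter.univ_mem ?_ ?_ ?_ ?_ ?_ ?_).2
    · exact Filter.Eventually.of_forall fun t =>
        ((hFc t).mono huI).aestronglyMeasurable measurableSet_uIoc
    · exact ((hFc 0).mono huIcc.subset).intervalIntegrable
    · exact ((hF'c 0).mono huI).aestronglyMeasurable measurableSet_uIoc
    · refine Filter.Eventually.of_forall fun r _ t _ => ?_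
      rw [norm_mul, norm_mul, Real.norm_eq_abs, Real.norm_eq_abs, Real.norm_eq_abs]
      gcongr
      exact hM _
    · apply ContinuousOn.intervalIntegrable
      rw [huIcc]
      fun_prop
    · refine Filter.Eventually.of_forall fun r _ t _ => ?_
      have h1 : HasDerivAt (fun t : ℝ => v₀ r + t * (w r - v₀ r)) (w r - v₀ r) t := by
        simpa using ((hasDerivAt_id t).mul_const (w r - v₀ r)).const_add (v₀ r)
      exact ((hGd _).comp t h1).const_mul (r ^ n)
  set Φ : ℝ → ℝ := fun t : ℝ => ∫ r in (0:ℝ)..ρ, r ^ n * G (v₀ r + t * (w r - v₀ r)) with hΦ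
  set Pw := ∫ r in (0:ℝ)..ρ, r ^ n * (1 - √(1 - (deriv w r) ^ 2)) with hPw
  set Pv := ∫ r in (0:ℝ)..ρ, r ^ n * (1 - √(1 - (deriv v₀ r) ^ 2)) with hPv
  have hΦ0 : Φ 0 = ∫ r in (0:ℝ)..ρ, r ^ n * G (v₀ r) := by simp [hΦ]
  -- bound on w - v₀
  obtain ⟨C, hC⟩ := isCompact_Icc.exists_bound_of_continuousOn (hwc.sub hvc)
  have hCpos : 0 ≤ C := (norm_nonneg _).trans (hC 0 ⟨le_rfl, hρ.le⟩)
  have hstep : ∀ t : ℝ, 0 < t → t ≤ 1 → t * C < ε → lam * (Φ t - Φ 0) ≤ t * (Pw - Pv) := by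
    intro t ht0 ht1 htC
    have hmem : MemK ρ (fun r => v₀ r + t * (w r - v₀ r)) := by
      refine ⟨LipschitzOnWith.of_dist_le_mul fun x hx y hy => ?_, ?_⟩
      · have h1 := hv₀.1.dist_le_mul x hx y hy
        have h2 := hw.1.dist_le_mul x hx y hy
        simp only [Real.dist_eq, NNReal.coe_one, one_mul] at h1 h2 ⊢
        calc |v₀ x + t * (w x - v₀ x) - (v₀ y + t * (w y - v₀ y))|
            = |(1 - t) * (v₀ x - v₀ y) + t * (w x - w y)| := by ring_nf
          _ ≤ |(1 - t) * (v₀ x - v₀ y)| + |t * (w x - w y)| := abs_add_le _ _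
          _ = (1 - t) * |v₀ x - v₀ y| + t * |w x - w y| := by
            rw [abs_mul, abs_mul, abs_of_nonneg (by linarith : 0 ≤ 1 - t), abs_of_pos ht0]
          _ ≤ (1 - t) * |x - y| + t * |x - y| := by
            gcongr
          _ = |x - y| := by ring
      · simp [hv₀.2, hw.2]
    have h := hmin _ hmem (fun r hr => by
      have := hC r hr
      simp only [Pi.sub_apply, Real.norm_eq_abs] at this
      rw [add_sub_cancel_left, abs_mul, abs_of_pos ht0]
      exact (mul_le_mul_of_nonneg_left this ht0.le).trans_lt htC)
    have hconv : (∫ r in (0:ℝ)..ρ, r ^ n *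
        (1 - √(1 - (deriv (fun r => v₀ r + t * (w r - v₀ r)) r) ^ 2))) ≤ Pv + t * (Pw - Pv) := by
      have e : Pv + t * (Pw - Pv) = ∫ r in (0:ℝ)..ρ, (r ^ n * (1 - √(1 - (deriv v₀ r) ^ 2)) +
          t * (r ^ n * (1 - √(1 - (deriv w r) ^ 2)) - r ^ n * (1 - √(1 - (deriv v₀ r) ^ 2)))) := by
        have i1 := aux_psi_int n ρ hρ v₀
        have i2 := aux_psi_int n ρ hρ w
        rw [intervalIntegral.integral_add i1 ((i2.sub i1).const_mul t),
          intervalIntegral.integral_const_mul, intervalIntegral.integral_sub i2 i1]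
      rw [e]
      have i1 := aux_psi_int n ρ hρ v₀
      have i2 := aux_psi_int n ρ hρ w
      refine intervalIntegral.integral_mono_ae_restrict hρ.le (aux_psi_int n ρ hρ _)
        (i1.add ((i2.sub i1).const_mul t)) ?_
      have d1 := (aux_ac ρ hρ v₀ hv₀).ae_differentiableAt
      have d2 := (aux_ac ρ hρ w hw).ae_differentiableAt
      rw [← restrict_Ioo_eq_restrict_Icc, Filter.EventuallyLE, ae_restrict_iff' measurableSet_Ioo]
      filter_upwards [d1, d2] with r hr1 hr2 hr
      rw [huIcc] at hr1 hr2
      have hr1 := (hr1 ⟨hr.1.le, hr.2.le⟩).hasDerivAt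
      have hr2 := (hr2 ⟨hr.1.le, hr.2.le⟩).hasDerivAt
      have hd : deriv (fun r => v₀ r + t * (w r - v₀ r)) r
          = deriv v₀ r + t * (deriv w r - deriv v₀ r) :=
        (hr1.add ((hr2.sub hr1).const_mul t)).deriv
      have hc := aux_convex (deriv v₀ r) (deriv w r) t (aux_deriv_le ρ v₀ hv₀ r hr)
        (aux_deriv_le ρ w hw r hr) ht0.le ht1
      simp only [hd]
      have := mul_le_mul_of_nonneg_left hc (pow_nonneg hr.1.le n)
      linarith
    have hΦt : Φ t = ∫ r in (0:ℝ)..ρ, r ^ n * G (v₀ r + t * (w r - v₀ r)) := rfl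
    rw [← hΦ0, ← hΦt] at h
    linarith
  have hs := (hasDerivAt_iff_tendsto_slope.1 hder).mono_left
    (nhdsWithin_mono 0 (fun x (hx : x ∈ Set.Ioi (0:ℝ)) => (ne_of_gt hx : x ≠ 0)))
  have hs2 := hs.const_mul lam
  simp only [zero_mul, add_zero] at hs2
  refine le_of_tendsto hs2 ?_
  have hsmall : ∀ᶠ t in 𝓝[>] (0:ℝ), t < min 1 (ε / (C + 1)) :=
    nhdsWithin_le_nhds (gt_mem_nhds (by positivity))
  filter_upwards [hsmall, self_mem_nhdsWithin] with t ht ht0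
  have ht0 : 0 < t := ht0
  have ht1 := ht.trans_le (min_le_left _ _)
  have ht2 := ht.trans_le (min_le_right _ _)
  rw [lt_div_iff₀ (by positivity)] at ht2
  have := hstep t ht0 ht1.le (by nlinarith)
  rw [slope_def_field, sub_zero, ← mul_div_assoc, div_le_iff₀ ht0]
  linarith

open MeasureTheory in
/-- Lemma 2.3: a local minimum (for the sup norm) of `J` on `K_ρ` is a classical
solution of the radial Dirichlet problem on the ball `B_ρ`. -/
theorem lemma23_local_min_is_classical_solution
    (N : ℕ) (hN : 2 ≤ N) (lam : ℝ) (hlam : 0 < lam) (ρ : ℝ) (hρ : 0 < ρ)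
    (g : ℝ → ℝ) (hgb : ∃ M : ℝ, ∀ s, |g s| ≤ M) (hgLip : LocallyLipschitz g)
    (v₀ : ℝ → ℝ) (hv₀ : MemK ρ v₀)
    (hmin : ∃ ε > (0:ℝ), ∀ v : ℝ → ℝ, MemK ρ v →
      (∀ r ∈ Set.Icc (0:ℝ) ρ, |v r - v₀ r| < ε) →
      Jfunc N lam ρ (fun u => ∫ s in (0:ℝ)..u, g s) v₀ ≤
        Jfunc N lam ρ (fun u => ∫ s in (0:ℝ)..u, g s) v) :
    ∃ v' : ℝ → ℝ,
      ContDiffOn ℝ 2 v₀ (Set.Icc 0 ρ) ∧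
      (∀ r ∈ Set.Icc (0:ℝ) ρ, HasDerivWithinAt v₀ (v' r) (Set.Icc 0 ρ) r) ∧
      (∀ r ∈ Set.Icc (0:ℝ) ρ, |v' r| < 1) ∧
      v' 0 = 0 ∧ v₀ ρ = 0 ∧
      ∀ r ∈ Set.Ioo (0:ℝ) ρ,
        HasDerivAt (fun s => v' s / Real.sqrt (1 - (v' s) ^ 2))
          (-(((N : ℝ) - 1) / r * (v' r / Real.sqrt (1 - (v' r) ^ 2)) + lam * g (v₀ r))) r := by
  have hgc := hgLip.continuous
  have hvc : ContinuousOn v₀ (Set.Icc 0 ρ) := hv₀.1.continuousOn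
  -- a globally continuous version of `lam * g (v₀ r)`
  obtain ⟨h, hh, hhe⟩ : ∃ h : ℝ → ℝ, Continuous h ∧ ∀ r ∈ Set.Icc 0 ρ, h r = lam * g (v₀ r) := by
    refine ⟨fun r => lam * g (v₀ (Set.projIcc 0 ρ hρ.le r)), ?_, ?_⟩
    · have : Continuous fun r => v₀ (Set.projIcc 0 ρ hρ.le r) :=
        hvc.comp_continuous (continuous_subtype_val.comp continuous_projIcc) (fun r => (Set.projIcc 0 ρ hρ.le r).2)
      exact continuous_const.mul (hgc.comp this)
    · intro r hr
      simp [Set.projIcc_of_mem hρ.le hr]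
  obtain ⟨p, hp0, hpC, hpH, hpd⟩ := aux_p (N - 1) (by omega) h hh
  have hpc := hpC.continuous
  have hpos : ∀ r, 0 < 1 + p r ^ 2 := fun r => by positivity
  set d : ℝ → ℝ := fun r => -p r / √(1 + p r ^ 2) with hd
  have hdC : ContDiff ℝ 1 d := by
    refine hpC.neg.div ((contDiff_const.add (hpC.pow 2)).sqrt fun r => (hpos r).ne') fun r => ?_
    exact (Real.sqrt_pos.2 (hpos r)).ne'
  have hdc := hdC.continuous
  have hdsq : ∀ r, 1 - d r ^ 2 = (1 / √(1 + p r ^ 2)) ^ 2 := by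
    intro r
    have := hpos r
    simp only [hd, div_pow, Real.sq_sqrt this.le]
    field_simp
    ring
  have hdlt : ∀ r, |d r| < 1 := by
    intro r
    have h1 : 0 < 1 - d r ^ 2 := by
      rw [hdsq]; have := Real.sqrt_pos.2 (hpos r); positivity
    rw [← sq_lt_one_iff_abs_lt_one]; linarith
  have hdphi : ∀ r, d r / √(1 - d r ^ 2) = -p r := by
    intro r
    have := Real.sqrt_pos.2 (hpos r)
    rw [hdsq, Real.sqrt_sq (by positivity)]
    simp only [hd]
    field_simp
  set w : ℝ → ℝ := fun r => ∫ s in ρ..r, d s with hw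
  have hwd : ∀ r, HasDerivAt w (d r) r := fun r => (hdc.integral_hasStrictDerivAt ρ r).hasDerivAt
  have hwderiv : deriv w = d := funext fun r => (hwd r).deriv
  have hwC : ContDiff ℝ 2 w := by
    rw [show (2 : WithTop ℕ∞) = 1 + 1 from by norm_num, contDiff_succ_iff_deriv]
    refine ⟨fun r => (hwd r).differentiableAt, by simp, ?_⟩
    rw [hwderiv]; exact hdC
  have hwK : MemK ρ w := by
    refine ⟨LipschitzWith.lipschitzOnWith ?_, by simp [hw]⟩
    refine lipschitzWith_of_nnnorm_deriv_le (fun r => (hwd r).differentiableAt) fun r => ?_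
    rw [hwderiv, ← NNReal.coe_le_coe]
    simpa using (hdlt r).le
  have huIcc : Set.uIcc 0 ρ = Set.Icc 0 ρ := Set.uIcc_of_le hρ.le
  have hvar := aux_variational N lam hlam ρ hρ g hgb hgc v₀ hv₀ hmin w hwK
  generalize hn : N - 1 = n at *
  have acv := aux_ac ρ hρ v₀ hv₀
  have acw := aux_ac ρ hρ w hwK
  have acu : AbsolutelyContinuousOnInterval (fun r => v₀ r - w r) 0 ρ := acv.sub acw
  have hderu : ∀ᵐ r, r ∈ Set.Icc 0 ρ → deriv (fun r => v₀ r - w r) r = deriv v₀ r - d r := by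
    filter_upwards [acv.ae_differentiableAt] with r hr hr'
    exact ((hr (huIcc ▸ hr')).hasDerivAt.sub (hwd r)).deriv
  set H : ℝ → ℝ := fun r => r ^ n * p r with hH
  have hHd : ∀ r, HasDerivAt H (r ^ n * h r) r := by
    intro r
    have : Continuous (fun s => s ^ n * h s) := by fun_prop
    rw [show H = fun r => ∫ s in (0:ℝ)..r, s ^ n * h s from funext hpH]
    exact this.integral_hasStrictDerivAt 0 r |>.hasDerivAt
  have hHderiv : deriv H = fun r => r ^ n * h r := funext fun r => (hHd r).deriv
  have acH : AbsolutelyContinuousOnInterval H 0 ρ := by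
    have : Continuous (fun s => s ^ n * h s) := by fun_prop
    rw [show H = fun r => ∫ s in (0:ℝ)..r, s ^ n * h s from funext hpH]
    exact (this.intervalIntegrable 0 ρ).absolutelyContinuousOnInterval_intervalIntegral (by simp)
  have hparts := acH.integral_mul_deriv_eq_deriv_mul acu
  have hH0 : H 0 = 0 := by simp [hH, hp0]
  rw [hHderiv, hH0, hv₀.2, hwK.2] at hparts
  simp only [sub_self, mul_zero, zero_mul, zero_sub] at hparts
  -- rewrite variational inequality
  have hvar2 : lam * (∫ r in (0:ℝ)..ρ, r ^ n * (g (v₀ r) * (w r - v₀ r)))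
      = - ∫ r in (0:ℝ)..ρ, r ^ n * h r * (v₀ r - w r) := by
    rw [← intervalIntegral.integral_const_mul, ← intervalIntegral.integral_neg]
    apply intervalIntegral.integral_congr
    intro r hr
    rw [huIcc] at hr
    simp only [hhe r hr]
    ring
  rw [hvar2, ← hparts] at hvar
  -- the deficit
  have mdv := measurable_deriv v₀
  have i1 := aux_psi_int n ρ hρ v₀
  have i2 := aux_psi_int n ρ hρ w
  have i3 : IntervalIntegrable (fun r => H r * deriv (fun r => v₀ r - w r) r) volume 0 ρ :=
    acu.intervalIntegrable_deriv.continuousOn_mul acH.continuousOn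
  have i4 : IntervalIntegrable (fun r => r ^ n * ((deriv v₀ r - d r) ^ 2 / 2)) volume 0 ρ := by
    refine aux_int _ (by fun_prop) ρ hρ.le (ρ ^ n * 2) ?_
    intro r hr
    have hr0 : 0 ≤ r ^ n := pow_nonneg hr.1.le n
    rw [abs_of_nonneg (by positivity)]
    have a1 := abs_le.1 (aux_deriv_le ρ v₀ hv₀ r hr)
    have a2 := abs_le.1 (hdlt r).le
    have : (deriv v₀ r - d r) ^ 2 / 2 ≤ 2 := by nlinarith
    have h3 : r ^ n ≤ ρ ^ n := pow_le_pow_left₀ hr.1.le hr.2.le n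
    gcongr
  have hdef : (∫ r in (0:ℝ)..ρ, r ^ n * ((deriv v₀ r - d r) ^ 2 / 2)) ≤
      ∫ r in (0:ℝ)..ρ, (r ^ n * (1 - √(1 - (deriv v₀ r) ^ 2)) -
        r ^ n * (1 - √(1 - (deriv w r) ^ 2)) + H r * deriv (fun r => v₀ r - w r) r) := by
    refine intervalIntegral.integral_mono_ae_restrict hρ.le i4 ((i1.sub i2).add i3) ?_
    rw [← restrict_Ioo_eq_restrict_Icc, Filter.EventuallyLE, ae_restrict_iff' measurableSet_Ioo]
    filter_upwards [hderu] with r hr1 hr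
    rw [hr1 ⟨hr.1.le, hr.2.le⟩, hwderiv]
    have hc := aux_deficit (p r) (deriv v₀ r) (aux_deriv_le ρ v₀ hv₀ r hr)
    change (1 - √(1 - d r ^ 2)) - p r * (deriv v₀ r - d r) + (deriv v₀ r - d r) ^ 2 / 2 ≤
      1 - √(1 - deriv v₀ r ^ 2) at hc
    have := mul_le_mul_of_nonneg_left hc (pow_nonneg hr.1.le n)
    simp only [hH]
    linarith
  rw [intervalIntegral.integral_add (i1.sub i2) i3, intervalIntegral.integral_sub i1 i2] at hdef
  have hnn : 0 ≤ᵐ[volume.restrict (Set.Ioc 0 ρ)] fun r => r ^ n * ((deriv v₀ r - d r) ^ 2 / 2) := by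
    rw [Filter.EventuallyLE, ae_restrict_iff' measurableSet_Ioc]
    refine Filter.Eventually.of_forall fun r hr => ?_
    have hr0 : 0 ≤ r ^ n := pow_nonneg hr.1.le n
    simp only [Pi.zero_apply]
    positivity
  have hzero : (∫ r in (0:ℝ)..ρ, r ^ n * ((deriv v₀ r - d r) ^ 2 / 2)) = 0 := by
    apply le_antisymm
    · linarith
    · exact intervalIntegral.integral_nonneg_of_ae_restrict hρ.le
        (by rwa [← restrict_Ioc_eq_restrict_Icc])
  rw [intervalIntegral.integral_eq_zero_iff_of_le_of_nonneg_ae hρ.le hnn i4, Filter.EventuallyEq,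
    ae_restrict_iff' measurableSet_Ioc] at hzero
  have heq : ∀ r ∈ Set.Icc 0 ρ, v₀ r = w r := by
    intro x hx
    have hsub : Set.uIcc x ρ ⊆ Set.uIcc 0 ρ := by
      rw [huIcc, Set.uIcc_of_le hx.2]; exact Set.Icc_subset_Icc_left hx.1
    have e1 := (acu.mono hsub).integral_deriv_eq_sub
    have e2 : (∫ r in x..ρ, deriv (fun r => v₀ r - w r) r) = 0 := by
      apply intervalIntegral.integral_zero_ae
      filter_upwards [hderu, hzero] with r hr1 hr2 hr
      rw [Set.uIoc_of_le hx.2] at hr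
      have hr0 : 0 < r := lt_of_le_of_lt hx.1 hr.1
      rw [hr1 ⟨hr0.le, hr.2⟩]
      have h3 := hr2 ⟨hr0, hr.2⟩
      have h4 : r ^ n ≠ 0 := pow_ne_zero n hr0.ne'
      simpa [h4] using h3
    rw [e2, hv₀.2, hwK.2] at e1
    linarith
  refine ⟨d, hwC.contDiffOn.congr heq, ?_, fun r _ => hdlt r, by simp [hd, hp0], hv₀.2, ?_⟩
  · intro r hr
    exact (hwd r).hasDerivWithinAt.congr heq (heq r hr)
  · intro r hr
    have e : (fun s => d s / √(1 - d s ^ 2)) = fun s => -p s := funext hdphi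
    rw [e, hdphi r]
    have := (hpd r hr.1.ne').neg
    rw [hhe r ⟨hr.1.le, hr.2.le⟩] at this
    have hN' : (n : ℝ) = (N : ℝ) - 1 := by rw [← hn, Nat.cast_sub (by omega)]; simp
    rw [hN'] at this
    have e2 : -(((N : ℝ) - 1) / r * -p r + lam * g (v₀ r)) =
        -(lam * g (v₀ r) - ((N : ℝ) - 1) / r * p r) := by ring
    rw [e2]
    exact this
end

section
/- (Lemma 2.7.) Let N ≥ 2, λ > 0, and let f : ℝ → ℝ satisfy (A1)–(A2) with f(s) = 0 for s ≤ 0. Fix k ∈ {1,…,n}. For ζ ∈ (α_k, β_k), let u_ζ denote the maximally extended solution of the initial value problem (u'(r)/√(1−u'(r)²))' + ((N−1)/r)·u'(r)/√(1−u'(r)²) + λ·f(u(r)) = 0, u(0) = ζ, u'(0) = 0, with |u'| < 1. Define the sets I_k⁺ := {ζ ∈ (α_k, β_k) : there exists R' > 0 with u_ζ(r) > 0 and u_ζ'(r) < 0 for r ∈ (0,R') and u_ζ'(R') = 0} and I_k⁻ := {ζ ∈ (α_k, β_k) : there exists R' > 0 with u_ζ(r) > 0 and u_ζ'(r) < 0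 for r ∈ (0,R') and u_ζ(R') = 0}. Then I_k⁺ and I_k⁻ are disjoint and both are open subsets of (α_k, β_k). -/
open Set Filter

/-- A pair `(u, u')` is a solution of the radial mean curvature IVP with parameter `lam`,
nonlinearity `f` and initial value `ζ` on the domain `D`. -/
def IsRadialSol (N : ℕ) (lam : ℝ) (f : ℝ → ℝ) (ζ : ℝ) (D : Set ℝ) (u u' : ℝ → ℝ) : Prop :=
  ContDiffOn ℝ 2 u D ∧
  (∀ r ∈ D, HasDerivWithinAt u (u' r) D r) ∧
  u 0 = ζ ∧ u' 0 = 0 ∧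
  (∀ r ∈ D, |u' r| < 1) ∧
  (∀ r ∈ D, 0 < r → HasDerivWithinAt (fun s => u' s / Real.sqrt (1 - (u' s) ^ 2))
    (-(((N : ℝ) - 1) / r * (u' r / Real.sqrt (1 - (u' r) ^ 2)) + lam * f (u r))) D r)

/-- The domain of a radial solution: either all of `[0,∞)` or a bounded interval `[0,R)`. -/
def IsSolDomain (D : Set ℝ) : Prop :=
  D = Set.Ici (0:ℝ) ∨ ∃ R > (0:ℝ), D = Set.Ico 0 R


noncomputable def psi (w : ℝ) : ℝ := w / Real.sqrt (1 + w ^ 2)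

lemma psi_sqrt_pos (w : ℝ) : 0 < Real.sqrt (1 + w ^ 2) := Real.sqrt_pos.2 (by positivity)

lemma psi_contDiff : ContDiff ℝ 2 psi := by
  unfold psi
  apply ContDiff.div contDiff_id
  · apply ContDiff.sqrt (by fun_prop)
    intro x; positivity
  · intro x; exact (psi_sqrt_pos x).ne'

lemma psi_continuous : Continuous psi := psi_contDiff.continuous

lemma psi_hasDerivAt (w : ℝ) : HasDerivAt psi (1 / (Real.sqrt (1 + w ^ 2)) ^ 3) w := by
  have h1 : HasDerivAt (fun w : ℝ => 1 + w ^ 2) (2 * w) w := by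
    simpa using (hasDerivAt_pow 2 w).const_add 1
  have h2 := (hasDerivAt_id w).div (h1.sqrt (by positivity)) (psi_sqrt_pos w).ne'
  refine HasDerivAt.congr_deriv h2 ?_
  have h3 := psi_sqrt_pos w
  have h4 : Real.sqrt (1 + w ^ 2) ^ 2 = 1 + w ^ 2 := Real.sq_sqrt (by positivity)
  simp only [id_eq]
  field_simp
  rw [h4]; ring

lemma psi_lip (a b : ℝ) : |psi a - psi b| ≤ |a - b| := by
  have := Convex.norm_image_sub_le_of_norm_hasDerivWithin_le (f := psi) (s := univ) (C := 1)
    (fun x _ => (psi_hasDerivAt x).hasDerivWithinAt) (fun x _ => by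
      rw [Real.norm_eq_abs, abs_of_pos (by have := psi_sqrt_pos x; positivity)]
      rw [div_le_one (by have := psi_sqrt_pos x; positivity)]
      apply one_le_pow₀
      rw [Real.one_le_sqrt]; nlinarith [sq_nonneg x]) convex_univ (mem_univ b) (mem_univ a)
  simpa using this

lemma psi_abs_lt (w : ℝ) : |psi w| < 1 := by
  unfold psi
  rw [abs_div, abs_of_pos (psi_sqrt_pos w), div_lt_one (psi_sqrt_pos w)]
  apply Real.lt_sqrt_of_sq_lt
  rw [sq_abs]; linarith

lemma psi_neg_iff (w : ℝ) : psi w < 0 ↔ w < 0 := by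
  unfold psi
  rw [div_lt_iff₀ (psi_sqrt_pos w), zero_mul]

lemma psi_eq_zero_iff (w : ℝ) : psi w = 0 ↔ w = 0 := by
  unfold psi
  rw [div_eq_zero_iff]
  simp [(psi_sqrt_pos w).ne']

lemma psi_inv (w : ℝ) : psi w / Real.sqrt (1 - psi w ^ 2) = w := by
  have h3 := psi_sqrt_pos w
  have h4 : Real.sqrt (1 + w ^ 2) ^ 2 = 1 + w ^ 2 := Real.sq_sqrt (by positivity)
  have : 1 - psi w ^ 2 = (1 / Real.sqrt (1 + w ^ 2)) ^ 2 := by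
    unfold psi
    rw [div_pow, div_pow, h4]
    field_simp; ring
  rw [this, Real.sqrt_sq (by positivity)]
  unfold psi
  field_simp

lemma psi_phi (p : ℝ) (hp : |p| < 1) : psi (p / Real.sqrt (1 - p ^ 2)) = p := by
  have h0 : 0 < 1 - p ^ 2 := by
    have := (sq_lt_one_iff_abs_lt_one p).2 hp
    linarith
  have h3 := Real.sqrt_pos.2 h0
  have h4 : Real.sqrt (1 - p ^ 2) ^ 2 = 1 - p ^ 2 := Real.sq_sqrt h0.le
  have : 1 + (p / Real.sqrt (1 - p ^ 2)) ^ 2 = (1 / Real.sqrt (1 - p ^ 2)) ^ 2 := by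
    rw [div_pow, div_pow, h4]
    field_simp; ring
  unfold psi
  rw [this, Real.sqrt_sq (by positivity)]
  field_simp

noncomputable def GG (m : ℕ) (g : ℝ → ℝ) (s : ℝ) : ℝ := ∫ τ in (0:ℝ)..1, τ ^ m * g (s * τ)

lemma GG_cont (m : ℕ) {g : ℝ → ℝ} (hg : Continuous g) : Continuous (GG m g) := by
  unfold GG
  apply intervalIntegral.continuous_parametric_intervalIntegral_of_continuous'
  fun_prop

lemma GG_pow (m : ℕ) (g : ℝ → ℝ) (s : ℝ) :
    s ^ (m + 1) * GG m g s = ∫ t in (0:ℝ)..s, t ^ m * g t := by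
  have h := intervalIntegral.smul_integral_comp_mul_left (fun t => t ^ m * g t) s (a := 0) (b := 1)
  simp only [mul_zero, mul_one] at h
  rw [← h]
  unfold GG
  rw [smul_eq_mul, pow_succ', mul_assoc, ← intervalIntegral.integral_const_mul]
  congr 2
  ext τ; ring

lemma GG_zero (m : ℕ) (g : ℝ → ℝ) : GG m g 0 = g 0 / (m + 1) := by
  unfold GG
  simp only [zero_mul]
  rw [intervalIntegral.integral_mul_const, integral_pow]
  simp; ring

lemma GG_deriv (m : ℕ) {g : ℝ → ℝ} (hg : Continuous g) (s : ℝ) :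
    HasDerivAt (fun s => s * GG m g s) (g s - m * GG m g s) s := by
  rcases eq_or_ne s 0 with rfl | hs
  · have h1 : g 0 - m * GG m g 0 = GG m g 0 := by
      rw [GG_zero]; field_simp; ring
    rw [h1, hasDerivAt_iff_tendsto_slope]
    have h2 : Tendsto (GG m g) (nhdsWithin 0 {0}ᶜ) (nhds (GG m g 0)) :=
      (GG_cont m hg).continuousAt.tendsto.mono_left nhdsWithin_le_nhds
    refine h2.congr' ?_
    filter_upwards [self_mem_nhdsWithin] with x hx
    have hx : x ≠ 0 := hx
    rw [slope_def_field]; field_simp; simp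
  · have hI : HasDerivAt (fun s => ∫ t in (0:ℝ)..s, t ^ m * g t) (s ^ m * g s) s := by
      have hc : Continuous (fun t => t ^ m * g t) := by fun_prop
      exact intervalIntegral.integral_hasDerivAt_right (hc.intervalIntegrable _ _)
        (hc.stronglyMeasurableAtFilter _ _) hc.continuousAt
    have h2 := hI.div (hasDerivAt_pow m s) (pow_ne_zero m hs)
    have h3 : HasDerivAt (fun s => s * GG m g s)
        ((s ^ m * g s * s ^ m - (∫ t in (0:ℝ)..s, t ^ m * g t) * (m * s ^ (m - 1))) / (s ^ m) ^ 2) s := by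
      refine h2.congr_of_eventuallyEq ?_
      filter_upwards [isOpen_ne.mem_nhds hs] with x hx
      have hx : x ≠ 0 := hx
      simp only [Pi.div_apply]
      rw [← GG_pow]; field_simp; ring
    convert h3 using 1
    rw [← GG_pow]
    rcases m with _ | m
    · simp
    · simp only [Nat.add_sub_cancel]
      field_simp; ring

lemma GG_bound (m : ℕ) {g₁ g₂ : ℝ → ℝ} (h₁ : Continuous g₁) (h₂ : Continuous g₂) {s c : ℝ}
    (hs : 0 ≤ s) (h : ∀ t ∈ Icc 0 s, |g₁ t - g₂ t| ≤ c) : |GG m g₁ s - GG m g₂ s| ≤ c := by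
  unfold GG
  rw [← intervalIntegral.integral_sub (Continuous.intervalIntegrable (by fun_prop) _ _)
    (Continuous.intervalIntegrable (by fun_prop) _ _)]
  have := intervalIntegral.norm_integral_le_of_norm_le_const (a := 0) (b := 1) (C := c)
    (f := fun τ => τ ^ m * g₁ (s * τ) - τ ^ m * g₂ (s * τ)) (by
      intro τ hτ
      rw [uIoc_of_le zero_le_one] at hτ
      have h1 : τ ^ m ≤ 1 := pow_le_one₀ hτ.1.le hτ.2
      have h0 : 0 ≤ τ ^ m := pow_nonneg hτ.1.le m
      have h3 := h (s * τ) ⟨mul_nonneg hs hτ.1.le, mul_le_of_le_one_right hs hτ.2⟩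
      rw [← mul_sub, Real.norm_eq_abs, abs_mul, abs_of_nonneg h0]
      nlinarith [abs_nonneg (g₁ (s * τ) - g₂ (s * τ))])
  simpa using this

lemma GG_pos (m : ℕ) {g : ℝ → ℝ} (hg : Continuous g) {s : ℝ}
    (hs : 0 ≤ s) (h : ∀ t ∈ Icc 0 s, 0 < g t) : 0 < GG m g s := by
  unfold GG
  apply intervalIntegral.intervalIntegral_pos_of_pos_on
  · exact Continuous.intervalIntegrable (by fun_prop) _ _
  · intro τ hτ
    have := h (s * τ) ⟨mul_nonneg hs hτ.1.le, mul_le_of_le_one_right hs hτ.2.le⟩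
    have := pow_pos hτ.1 m
    positivity
  · exact zero_lt_one

lemma GG_congr (m : ℕ) {g₁ g₂ : ℝ → ℝ} {s : ℝ}
    (hs : 0 ≤ s) (h : ∀ t ∈ Icc 0 s, g₁ t = g₂ t) : GG m g₁ s = GG m g₂ s := by
  unfold GG
  apply intervalIntegral.integral_congr
  intro τ hτ
  rw [uIcc_of_le zero_le_one] at hτ
  simp only
  rw [h (s * τ) ⟨mul_nonneg hs hτ.1, mul_le_of_le_one_right hs hτ.2⟩]

noncomputable def WW (lam : ℝ) (m : ℕ) (g : ℝ → ℝ) (s : ℝ) : ℝ := -lam * (s * GG m g s)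

noncomputable def Phi (lam : ℝ) (m : ℕ) (ζ : ℝ) (g : ℝ → ℝ) (r : ℝ) : ℝ :=
  ζ + ∫ s in (0:ℝ)..r, psi (WW lam m g s)

lemma WW_deriv (lam : ℝ) (m : ℕ) {g : ℝ → ℝ} (hg : Continuous g) (s : ℝ) :
    HasDerivAt (WW lam m g) (-lam * (g s - m * GG m g s)) s :=
  (GG_deriv m hg s).const_mul (-lam)

lemma WW_contDiff (lam : ℝ) (m : ℕ) {g : ℝ → ℝ} (hg : Continuous g) :
    ContDiff ℝ 1 (WW lam m g) := by
  rw [contDiff_one_iff_deriv]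
  refine ⟨fun s => (WW_deriv lam m hg s).differentiableAt, ?_⟩
  have : deriv (WW lam m g) = fun s => -lam * (g s - m * GG m g s) :=
    funext fun s => (WW_deriv lam m hg s).deriv
  rw [this]
  have := GG_cont m hg
  fun_prop

lemma WW_cont (lam : ℝ) (m : ℕ) {g : ℝ → ℝ} (hg : Continuous g) : Continuous (WW lam m g) :=
  (WW_contDiff lam m hg).continuous

lemma psiW_cont (lam : ℝ) (m : ℕ) {g : ℝ → ℝ} (hg : Continuous g) :
    Continuous (fun s => psi (WW lam m g s)) := psi_continuous.comp (WW_cont lam m hg)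

lemma Phi_deriv (lam : ℝ) (m : ℕ) (ζ : ℝ) {g : ℝ → ℝ} (hg : Continuous g) (r : ℝ) :
    HasDerivAt (Phi lam m ζ g) (psi (WW lam m g r)) r := by
  have hc := psiW_cont lam m hg
  exact (intervalIntegral.integral_hasDerivAt_right (hc.intervalIntegrable _ _)
        (hc.stronglyMeasurableAtFilter _ _) hc.continuousAt).const_add ζ

lemma Phi_contDiff (lam : ℝ) (m : ℕ) (ζ : ℝ) {g : ℝ → ℝ} (hg : Continuous g) :
    ContDiff ℝ 2 (Phi lam m ζ g) := by
  rw [show (2 : WithTop ℕ∞) = 1 + 1 from by norm_num, contDiff_succ_iff_deriv]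
  refine ⟨fun s => (Phi_deriv lam m ζ hg s).differentiableAt, by simp, ?_⟩
  rw [show deriv (Phi lam m ζ g) = fun s => psi (WW lam m g s) from
    funext fun s => (Phi_deriv lam m ζ hg s).deriv]
  exact (psi_contDiff.of_le (by norm_num)).comp (WW_contDiff lam m hg)

lemma Phi_zero (lam : ℝ) (m : ℕ) (ζ : ℝ) (g : ℝ → ℝ) : Phi lam m ζ g 0 = ζ := by
  simp [Phi]

lemma Phi_sub_le (lam : ℝ) (m : ℕ) (ζ : ℝ) (g : ℝ → ℝ) {r : ℝ} (hr : 0 ≤ r) :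
    |Phi lam m ζ g r - ζ| ≤ r := by
  unfold Phi
  rw [add_sub_cancel_left]
  have := intervalIntegral.norm_integral_le_of_norm_le_const (a := 0) (b := r) (C := 1)
    (f := fun s => psi (WW lam m g s)) (fun s _ => (psi_abs_lt _).le)
  simpa [abs_of_nonneg hr] using this

lemma WW_diff (lam : ℝ) (hlam : 0 ≤ lam) (m : ℕ) {g₁ g₂ : ℝ → ℝ} (h₁ : Continuous g₁)
    (h₂ : Continuous g₂) {s c : ℝ}
    (hs : 0 ≤ s) (h : ∀ t ∈ Icc 0 s, |g₁ t - g₂ t| ≤ c) :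
    |WW lam m g₁ s - WW lam m g₂ s| ≤ lam * (s * c) := by
  unfold WW
  rw [← mul_sub, ← mul_sub, abs_mul, abs_mul, abs_neg, abs_of_nonneg hlam, abs_of_nonneg hs]
  have := GG_bound m h₁ h₂ hs h
  gcongr

/-- the weighted contraction estimate -/
lemma Phi_est (lam : ℝ) (hlam : 0 ≤ lam) (m : ℕ) (ζ₁ ζ₂ : ℝ) {F : ℝ → ℝ} {L T M d : ℝ} (hL : 0 ≤ L)
    (hF : ∀ x y, |F x - F y| ≤ L * |x - y|) (hFc : Continuous F) (hM : 0 < M)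
    (hMT : 2 * (lam * (T * L)) ≤ M) {v₁ v₂ : ℝ → ℝ} (h₁ : Continuous v₁) (h₂ : Continuous v₂)
    (hd : 0 ≤ d) (h : ∀ t ∈ Icc 0 T, |v₁ t - v₂ t| ≤ d * Real.exp (M * t)) {r : ℝ} (hr : r ∈ Icc 0 T) :
    |Phi lam m ζ₁ (F ∘ v₁) r - Phi lam m ζ₂ (F ∘ v₂) r| ≤ |ζ₁ - ζ₂| + d / 2 * Real.exp (M * r) := by
  have hc₁ := psiW_cont lam m (hFc.comp h₁)
  have hc₂ := psiW_cont lam m (hFc.comp h₂)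
  have e : Phi lam m ζ₁ (F ∘ v₁) r - Phi lam m ζ₂ (F ∘ v₂) r = (ζ₁ - ζ₂) +
      ∫ s in (0:ℝ)..r, (psi (WW lam m (F ∘ v₁) s) - psi (WW lam m (F ∘ v₂) s)) := by
    rw [intervalIntegral.integral_sub (hc₁.intervalIntegrable _ _) (hc₂.intervalIntegrable _ _)]
    unfold Phi; ring
  rw [e]
  refine (abs_add_le _ _).trans ?_
  gcongr
  have hT : 0 ≤ T := hr.1.trans hr.2
  have hb : ∀ s ∈ Icc 0 r, |psi (WW lam m (F ∘ v₁) s) - psi (WW lam m (F ∘ v₂) s)| ≤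
      d / 2 * (M * Real.exp (M * s)) := by
    intro s hs
    refine (psi_lip _ _).trans ?_
    refine (WW_diff lam hlam m (hFc.comp h₁) (hFc.comp h₂) hs.1
      (c := L * (d * Real.exp (M * s))) ?_).trans ?_
    · intro t ht
      refine (hF _ _).trans ?_
      refine mul_le_mul_of_nonneg_left ((h t ⟨ht.1, ht.2.trans (hs.2.trans hr.2)⟩).trans ?_) hL
      have := ht.2
      gcongr
    · have hsT : s ≤ T := hs.2.trans hr.2
      calc lam * (s * (L * (d * Real.exp (M * s)))) ≤ lam * (T * (L * (d * Real.exp (M * s)))) := by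
            gcongr
        _ = (2 * (lam * (T * L))) * (d / 2 * Real.exp (M * s)) := by ring
        _ ≤ M * (d / 2 * Real.exp (M * s)) := by gcongr
        _ = _ := by ring
  have hi : ∫ s in (0:ℝ)..r, d / 2 * (M * Real.exp (M * s)) = d / 2 * (Real.exp (M * r) - 1) := by
    have : ∀ s ∈ uIcc 0 r, HasDerivAt (fun s => d / 2 * Real.exp (M * s)) (d / 2 * (M * Real.exp (M * s))) s := by
      intro s _
      have := ((hasDerivAt_id s).const_mul M).exp.const_mul (d / 2)
      refine HasDerivAt.congr_deriv this ?_
      simp only [id_eq]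
      ring
    rw [intervalIntegral.integral_eq_sub_of_hasDerivAt this
      (Continuous.intervalIntegrable (by fun_prop) _ _)]
    simp; ring
  calc |∫ s in (0:ℝ)..r, (psi (WW lam m (F ∘ v₁) s) - psi (WW lam m (F ∘ v₂) s))|
      ≤ ∫ s in (0:ℝ)..r, |psi (WW lam m (F ∘ v₁) s) - psi (WW lam m (F ∘ v₂) s)| :=
        intervalIntegral.abs_integral_le_integral_abs hr.1
    _ ≤ ∫ s in (0:ℝ)..r, d / 2 * (M * Real.exp (M * s)) := by
        apply intervalIntegral.integral_mono_on hr.1 _ _ hb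
        · exact ((hc₁.sub hc₂).abs).intervalIntegrable _ _
        · exact Continuous.intervalIntegrable (by fun_prop) _ _
    _ = d / 2 * (Real.exp (M * r) - 1) := hi
    _ ≤ _ := by nlinarith

lemma exists_fix (lam : ℝ) (hlam : 0 ≤ lam) (m : ℕ) (ζ : ℝ) {F : ℝ → ℝ} {L T : ℝ} (hL : 0 ≤ L)
    (hF : ∀ x y, |F x - F y| ≤ L * |x - y|) (hFc : Continuous F) (hT : 0 ≤ T) :
    ∃ v : ℝ → ℝ, Continuous v ∧ ∀ r ∈ Icc 0 T, v r = Phi lam m ζ (F ∘ v) r := by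
  set M : ℝ := 2 * (lam * (T * L)) + 1 with hMdef
  have hM : 0 < M := by positivity
  let V : C(Icc (0:ℝ) T, ℝ) → ℝ → ℝ := fun w t => Real.exp (M * t) * IccExtend hT w t
  have hV : ∀ w, Continuous (V w) := by
    intro w
    have : Continuous (IccExtend hT w) := w.continuous.Icc_extend'
    exact (by fun_prop : Continuous fun t => Real.exp (M * t)).mul this
  let A : C(Icc (0:ℝ) T, ℝ) → C(Icc (0:ℝ) T, ℝ) := fun w =>
    ⟨fun r => Real.exp (-(M * r)) * Phi lam m ζ (F ∘ V w) r, by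
      have := (Phi_contDiff lam m ζ (hFc.comp (hV w))).continuous
      fun_prop⟩
  have hA : ContractingWith (1/2) A := by
    refine ⟨by rw [← NNReal.coe_lt_coe]; norm_num, LipschitzWith.of_dist_le_mul ?_⟩
    intro w₁ w₂
    rw [ContinuousMap.dist_le (by positivity)]
    intro r
    have hd : ∀ t ∈ Icc 0 T, |V w₁ t - V w₂ t| ≤ dist w₁ w₂ * Real.exp (M * t) := by
      intro t ht
      simp only [V]
      rw [← mul_sub, abs_mul, abs_of_pos (Real.exp_pos _), mul_comm,
        IccExtend_of_mem _ _ ht, IccExtend_of_mem _ _ ht, ← Real.dist_eq]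
      have := ContinuousMap.dist_apply_le_dist (f := w₁) (g := w₂) ⟨t, ht⟩
      gcongr
    have := Phi_est lam hlam m ζ ζ hL hF hFc hM (by linarith) (hV w₁) (hV w₂) dist_nonneg hd r.2
    simp only [A, ContinuousMap.coe_mk]
    rw [Real.dist_eq, ← mul_sub, abs_mul, abs_of_pos (Real.exp_pos _)]
    calc _ ≤ Real.exp (-(M * r)) * (|ζ - ζ| + dist w₁ w₂ / 2 * Real.exp (M * r)) := by gcongr
      _ = _ := by
        rw [sub_self, abs_zero, zero_add, mul_left_comm, ← Real.exp_add]
        simp; ring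
  let w := hA.fixedPoint
  refine ⟨V w, hV w, fun r hr => ?_⟩
  have h1 : A w = w := hA.fixedPoint_isFixedPt
  have h2 : V w r = Real.exp (M * r) * w ⟨r, hr⟩ := by
    simp only [V]; rw [IccExtend_of_mem _ _ hr]
  rw [h2]
  conv_lhs => rw [← h1]
  simp only [A, ContinuousMap.coe_mk]
  rw [← mul_assoc, ← Real.exp_add]
  simp

/-- continuous dependence of fixed points -/
lemma fix_dep (lam : ℝ) (hlam : 0 ≤ lam) (m : ℕ) {F : ℝ → ℝ} {L T : ℝ} (hL : 0 ≤ L)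
    (hF : ∀ x y, |F x - F y| ≤ L * |x - y|) (hFc : Continuous F) (hT : 0 ≤ T) :
    ∃ C : ℝ, 0 ≤ C ∧ ∀ (ζ₁ ζ₂ : ℝ) (v₁ v₂ : ℝ → ℝ), Continuous v₁ → Continuous v₂ →
      (∀ r ∈ Icc 0 T, v₁ r = Phi lam m ζ₁ (F ∘ v₁) r) →
      (∀ r ∈ Icc 0 T, v₂ r = Phi lam m ζ₂ (F ∘ v₂) r) →
      ∀ r ∈ Icc 0 T, |v₁ r - v₂ r| ≤ C * |ζ₁ - ζ₂| ∧
        |WW lam m (F ∘ v₁) r - WW lam m (F ∘ v₂) r| ≤ C * |ζ₁ - ζ₂| := by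
  set M : ℝ := 2 * (lam * (T * L)) + 1 with hMdef
  have hM : 0 < M := by positivity
  set C₁ : ℝ := 2 * Real.exp (M * T) with hC₁
  refine ⟨C₁ + lam * (T * (L * C₁)), by positivity, ?_⟩
  intro ζ₁ ζ₂ v₁ v₂ h₁ h₂ e₁ e₂
  have hcont : ContinuousOn (fun t => |v₁ t - v₂ t| * Real.exp (-(M * t))) (Icc 0 T) := by
    fun_prop
  obtain ⟨t₀, ht₀, hmax⟩ := isCompact_Icc.exists_isMaxOn (nonempty_Icc.2 hT) hcont
  set d := |v₁ t₀ - v₂ t₀| * Real.exp (-(M * t₀)) with hd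
  have hd0 : 0 ≤ d := by positivity
  have hb : ∀ t ∈ Icc 0 T, |v₁ t - v₂ t| ≤ d * Real.exp (M * t) := by
    intro t ht
    have h3 : |v₁ t - v₂ t| * Real.exp (-(M * t)) ≤ d := hmax ht
    rw [Real.exp_neg, ← div_eq_mul_inv, div_le_iff₀ (Real.exp_pos _)] at h3
    exact h3
  have h4 := Phi_est lam hlam m ζ₁ ζ₂ hL hF hFc hM (by linarith) h₁ h₂ hd0 hb ht₀
  rw [← e₁ _ ht₀, ← e₂ _ ht₀] at h4
  have h5 : |v₁ t₀ - v₂ t₀| = d * Real.exp (M * t₀) := by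
    rw [hd, mul_assoc, ← Real.exp_add]; simp
  rw [h5] at h4
  have h6 : 1 ≤ Real.exp (M * t₀) := Real.one_le_exp (mul_nonneg hM.le ht₀.1)
  have h7 : d ≤ 2 * |ζ₁ - ζ₂| := by nlinarith
  have hv : ∀ r ∈ Icc 0 T, |v₁ r - v₂ r| ≤ C₁ * |ζ₁ - ζ₂| := by
    intro r hr
    refine (hb r hr).trans ?_
    have h8 : Real.exp (M * r) ≤ Real.exp (M * T) := by
      have := hr.2
      gcongr
    calc d * Real.exp (M * r) ≤ (2 * |ζ₁ - ζ₂|) * Real.exp (M * T) := by gcongr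
      _ = _ := by rw [hC₁]; ring
  intro r hr
  constructor
  · refine (hv r hr).trans ?_
    have : 0 ≤ lam * (T * (L * C₁)) := by positivity
    have := abs_nonneg (ζ₁ - ζ₂)
    nlinarith
  · refine (WW_diff lam hlam m (hFc.comp h₁) (hFc.comp h₂) hr.1
      (c := L * (C₁ * |ζ₁ - ζ₂|)) ?_).trans ?_
    · intro t ht
      exact (hF _ _).trans (mul_le_mul_of_nonneg_left (hv t ⟨ht.1, ht.2.trans hr.2⟩) hL)
    · have hrT := hr.2
      calc lam * (r * (L * (C₁ * |ζ₁ - ζ₂|))) ≤ lam * (T * (L * (C₁ * |ζ₁ - ζ₂|))) := by gcongr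
        _ = (lam * (T * (L * C₁))) * |ζ₁ - ζ₂| := by ring
        _ ≤ _ := by
          have : 0 ≤ C₁ := by positivity
          gcongr
          linarith

lemma trunc (f : ℝ → ℝ) (hf : LocallyLipschitz f) (B : ℝ) (hB : 0 ≤ B) :
    ∃ (F : ℝ → ℝ) (L : ℝ), 0 ≤ L ∧ (∀ x y, |F x - F y| ≤ L * |x - y|) ∧ Continuous F ∧
      ∀ x, |x| ≤ B → F x = f x := by
  obtain ⟨K, hK⟩ := LocallyLipschitzOn.exists_lipschitzOnWith_of_compact
    (isCompact_Icc (a := -B) (b := B)) (hf.locallyLipschitzOn (s := Icc (-B) B))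
  let c : ℝ → ℝ := fun x => max (-B) (min x B)
  have hc : ∀ x, c x ∈ Icc (-B) B := fun x =>
    ⟨le_max_left _ _, max_le (by linarith) (min_le_right _ _)⟩
  have hcl : ∀ x y, |c x - c y| ≤ |x - y| := by
    intro x y
    refine (abs_max_sub_max_le_max _ _ _ _).trans ?_
    rw [sub_self, abs_zero]
    refine max_le (abs_nonneg _) ?_
    refine (abs_min_sub_min_le_max _ _ _ _).trans ?_
    rw [sub_self, abs_zero]
    exact max_le le_rfl (abs_nonneg _)
  refine ⟨fun x => f (c x), K, K.2, ?_, ?_, ?_⟩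
  · intro x y
    have := hK.dist_le_mul _ (hc x) _ (hc y)
    rw [Real.dist_eq, Real.dist_eq] at this
    refine this.trans ?_
    have := hcl x y
    gcongr
  · exact hf.continuous.comp (by fun_prop)
  · intro x hx
    have hx := abs_le.1 hx
    simp only [c]
    rw [min_eq_left hx.2, max_eq_right hx.1]

noncomputable def ph (p : ℝ) : ℝ := p / Real.sqrt (1 - p ^ 2)

lemma ph_contOn : ContinuousOn ph {p | |p| < 1} := by
  unfold ph
  apply ContinuousOn.div (by fun_prop)
  · apply ContinuousOn.sqrt; fun_prop
  · intro p hp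
    have := (sq_lt_one_iff_abs_lt_one p).2 hp
    exact (Real.sqrt_pos.2 (by linarith)).ne'

lemma solDom_unique {D : Set ℝ} (hD : IsSolDomain D) : UniqueDiffOn ℝ D := by
  rcases hD with rfl | ⟨R, _, rfl⟩
  · exact uniqueDiffOn_Ici 0
  · exact uniqueDiffOn_Ico 0 R

lemma solDom_sub {D : Set ℝ} (hD : IsSolDomain D) {T : ℝ} (hT : T ∈ D) : Icc 0 T ⊆ D := by
  rcases hD with rfl | ⟨R, _, rfl⟩
  · exact fun x hx => hx.1
  · exact fun x hx => ⟨hx.1, hx.2.trans_lt hT.2⟩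

lemma sol_phi_cont {N : ℕ} {lam : ℝ} {f : ℝ → ℝ} {ζ : ℝ} {D : Set ℝ} {u u' : ℝ → ℝ}
    (h : IsRadialSol N lam f ζ D u u') (hD : IsSolDomain D) :
    ContinuousOn (fun r => ph (u' r)) D := by
  obtain ⟨h1, h2, h3, h4, h5, h6⟩ := h
  have hu' : ContinuousOn u' D := by
    refine (h1.continuousOn_derivWithin (solDom_unique hD) (by norm_num)).congr ?_
    intro r hr
    exact ((h2 r hr).derivWithin (solDom_unique hD r hr)).symm
  exact ph_contOn.comp hu' (fun r hr => h5 r hr)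

lemma sol_lip {N : ℕ} {lam : ℝ} {f : ℝ → ℝ} {ζ : ℝ} {D : Set ℝ} {u u' : ℝ → ℝ}
    (h : IsRadialSol N lam f ζ D u u') (hD : IsSolDomain D) {r : ℝ} (hr0 : 0 ≤ r) (hr : r ∈ D) :
    |u r - ζ| ≤ r := by
  obtain ⟨h1, h2, h3, h4, h5, h6⟩ := h
  have := Convex.norm_image_sub_le_of_norm_hasDerivWithin_le (f := u) (f' := u') (s := Icc 0 r) (C := 1)
    (fun x hx => (h2 x (solDom_sub hD hr hx)).mono (solDom_sub hD hr))
    (fun x hx => (h5 x (solDom_sub hD hr hx)).le) (convex_Icc 0 r)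
    (left_mem_Icc.2 hr0) (right_mem_Icc.2 hr0)
  rw [h3] at this
  simpa [abs_of_nonneg hr0] using this

lemma sol_fix {m : ℕ} (hm : 1 ≤ m) {lam : ℝ} {f : ℝ → ℝ} {ζ : ℝ} {D : Set ℝ} {u u' : ℝ → ℝ}
    (h : IsRadialSol (m + 1) lam f ζ D u u') (hD : IsSolDomain D) {T : ℝ} (hT0 : 0 ≤ T) (hT : T ∈ D)
    {F : ℝ → ℝ} (hFc : Continuous F) {B : ℝ} (hFB : ∀ x, |x| ≤ B → F x = f x) (hB : |ζ| + T ≤ B) :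
    ∃ v : ℝ → ℝ, Continuous v ∧ (∀ r ∈ Icc 0 T, v r = u r ∧ F (v r) = f (u r) ∧
      v r = Phi lam m ζ (F ∘ v) r ∧ ph (u' r) = WW lam m (F ∘ v) r) := by
  have hsub := solDom_sub hD hT
  have hwc := (sol_phi_cont h hD).mono hsub
  have hlip : ∀ r ∈ Icc 0 T, |u r - ζ| ≤ r := fun r hr => sol_lip h hD hr.1 (hsub hr)
  obtain ⟨h1, h2, h3, h4, h5, h6⟩ := h
  have huc : ContinuousOn u (Icc 0 T) := h1.continuousOn.mono hsub
  let v : ℝ → ℝ := IccExtend hT0 (fun x : Icc (0:ℝ) T => u x)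
  have hv : Continuous v := (continuousOn_iff_continuous_domRestrict.1 huc).Icc_extend'
  have hvu : ∀ r ∈ Icc 0 T, v r = u r := fun r hr => IccExtend_of_mem _ _ hr
  have hFv : ∀ r ∈ Icc 0 T, F (v r) = f (u r) := by
    intro r hr
    rw [hvu r hr]
    apply hFB
    have h7 := hlip r hr
    have h8 := hr.2
    have : |u r| ≤ |u r - ζ| + |ζ| := by
      have := abs_add_le (u r - ζ) ζ
      simpa using this
    linarith
  have hg : Continuous (F ∘ v) := hFc.comp hv
  have hnh : ∀ x ∈ Ioo 0 T, D ∈ nhds x := fun x hx =>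
    mem_of_superset (Icc_mem_nhds hx.1 hx.2) hsub
  have hw : ∀ r ∈ Icc 0 T, ph (u' r) = WW lam m (F ∘ v) r := by
    intro r hr
    rcases hr.1.eq_or_lt with rfl | hr0
    · simp [h4, ph, WW]
    have hi := intervalIntegral.integral_eq_sub_of_hasDerivAt_of_le (a := 0) (b := r)
      (f := fun x => x ^ m * ph (u' x)) (f' := fun x => -lam * (x ^ m * (F ∘ v) x)) hr.1
      (by
        have := hwc.mono (Icc_subset_Icc_right hr.2)
        fun_prop)
      (by
        intro x hx
        have hx' : x ∈ Ioo 0 T := ⟨hx.1, hx.2.trans_le hr.2⟩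
        have hd := (h6 x (hsub (Ioo_subset_Icc_self hx')) hx.1).hasDerivAt (hnh x hx')
        have hd2 := (hasDerivAt_pow m x).mul hd
        refine HasDerivAt.congr_deriv hd2 ?_
        simp only [Function.comp]
        rw [hFv x (Ioo_subset_Icc_self hx')]
        obtain ⟨j, rfl⟩ : ∃ j, m = j + 1 := ⟨m - 1, by omega⟩
        have := hx.1.ne'
        push_cast
        field_simp
        try simp only [Nat.add_sub_cancel]
        try ring)
      (Continuous.intervalIntegrable (by fun_prop) _ _)
    rw [intervalIntegral.integral_const_mul, ← GG_pow] at hi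
    simp only [zero_pow (by omega : m ≠ 0), zero_mul, sub_zero] at hi
    have hp : r ^ m ≠ 0 := (pow_pos hr0 m).ne'
    apply mul_left_cancel₀ hp
    rw [← hi, WW]; ring
  refine ⟨v, hv, fun r hr => ⟨hvu r hr, hFv r hr, ?_, hw r hr⟩⟩
  rw [hvu r hr, Phi, intervalIntegral.integral_eq_sub_of_hasDerivAt_of_le (f := u) hr.1
    (huc.mono (Icc_subset_Icc_right hr.2)), h3]
  · ring
  · intro x hx
    have hx' : x ∈ Ioo 0 T := ⟨hx.1, hx.2.trans_le hr.2⟩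
    have hxD := hsub (Ioo_subset_Icc_self hx')
    rw [← hw x (Ioo_subset_Icc_self hx'), ph, psi_phi _ (h5 x hxD)]
    exact (h2 x hxD).hasDerivAt (hnh x hx')
  · exact (psiW_cont lam m hg).intervalIntegrable _ _

lemma fix_sol {m : ℕ} {lam : ℝ} {f : ℝ → ℝ} {ζ T : ℝ} {g : ℝ → ℝ} (hg : Continuous g)
    (h : ∀ r ∈ Ico 0 T, g r = f (Phi lam m ζ g r)) :
    IsRadialSol (m + 1) lam f ζ (Ico 0 T) (Phi lam m ζ g) (fun r => psi (WW lam m g r)) := by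
  refine ⟨(Phi_contDiff lam m ζ hg).contDiffOn, fun r _ => (Phi_deriv lam m ζ hg r).hasDerivWithinAt,
    Phi_zero _ _ _ _, by simp [WW, psi], fun r _ => psi_abs_lt _, ?_⟩
  intro r hr hr0
  simp only [psi_inv]
  refine HasDerivWithinAt.congr_deriv (WW_deriv lam m hg r).hasDerivWithinAt ?_
  rw [h r hr, WW]
  push_cast
  field_simp
  ring

lemma dom_eq {m : ℕ} (hm : 1 ≤ m) {lam : ℝ} (hlam : 0 ≤ lam) {f : ℝ → ℝ} (hf : LocallyLipschitz f)
    {ζ : ℝ} {D : Set ℝ} {u u' : ℝ → ℝ} (hD : IsSolDomain D)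
    (h : IsRadialSol (m + 1) lam f ζ D u u')
    (hmax : ∀ (E : Set ℝ) (v v' : ℝ → ℝ), IsSolDomain E → D ⊆ E → D ≠ E →
        IsRadialSol (m + 1) lam f ζ E v v' → ¬(∀ r ∈ D, v r = u r)) : D = Ici 0 := by
  rcases hD' : hD with h0 | ⟨R, hR, hDR⟩
  · exact h0
  exfalso
  obtain ⟨F, L, hL, hFL, hFc, hFB⟩ := trunc f hf (|ζ| + (R + 1)) (by positivity)
  obtain ⟨v, hv, hvfix⟩ := exists_fix lam hlam m ζ hL hFL hFc (T := R + 1) (by linarith)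
  have hg : Continuous (F ∘ v) := hFc.comp hv
  refine hmax (Ico 0 (R + 1)) (Phi lam m ζ (F ∘ v)) (fun r => psi (WW lam m (F ∘ v) r))
    (Or.inr ⟨R + 1, by linarith, rfl⟩) ?_ ?_ (fix_sol hg ?_) ?_
  · rw [hDR]; exact Ico_subset_Ico_right (by linarith)
  · rw [hDR]
    intro hE
    have : R ∈ Ico 0 (R + 1) := ⟨hR.le, by linarith⟩
    rw [← hE] at this
    exact lt_irrefl _ this.2
  · intro r hr
    have hr' := Ico_subset_Icc_self hr
    simp only [Function.comp]
    rw [hvfix r hr']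
    apply hFB
    have h7 := Phi_sub_le lam m ζ (F ∘ v) hr.1
    have h8 := hr.2
    have : |Phi lam m ζ (F ∘ v) r| ≤ |Phi lam m ζ (F ∘ v) r - ζ| + |ζ| := by
      have := abs_add_le (Phi lam m ζ (F ∘ v) r - ζ) ζ
      simpa using this
    linarith
  · intro r hr
    have hr2 : r ∈ Ico 0 R := hDR ▸ hr
    obtain ⟨v₂, hv₂, H⟩ := sol_fix hm h hD hr2.1 hr hFc hFB (by have := hr2.2; linarith)
    obtain ⟨C, _, hC⟩ := fix_dep lam hlam m hL hFL hFc hr2.1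
    have hrr := right_mem_Icc.2 hr2.1
    have := (hC ζ ζ v v₂ hv hv₂ (fun s hs => hvfix s ⟨hs.1, by linarith [hs.2, hr2.2]⟩)
      (fun s hs => (H s hs).2.2.1) r hrr).1
    rw [sub_self, abs_zero, mul_zero] at this
    rw [← hvfix r ⟨hr2.1, by linarith [hr2.2]⟩, ← (H r hrr).1]
    exact sub_eq_zero.1 (abs_nonpos_iff.1 this)

/-- continuous dependence on the initial value -/
lemma sol_dep {m : ℕ} (hm : 1 ≤ m) {lam : ℝ} (hlam : 0 ≤ lam) {f : ℝ → ℝ} (hf : LocallyLipschitz f)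
    {J : Set ℝ} {Z : ℝ} (hJ : ∀ ζ ∈ J, |ζ| ≤ Z) (hZ : 0 ≤ Z) {U U' : ℝ → ℝ → ℝ}
    (h : ∀ ζ ∈ J, IsRadialSol (m + 1) lam f ζ (Ici 0) (U ζ) (U' ζ)) {T : ℝ} (hT : 0 ≤ T) :
    ∃ C : ℝ, 0 ≤ C ∧ ∀ ζ₁ ∈ J, ∀ ζ₂ ∈ J, ∀ r ∈ Icc 0 T, |U ζ₁ r - U ζ₂ r| ≤ C * |ζ₁ - ζ₂| ∧
      |ph (U' ζ₁ r) - ph (U' ζ₂ r)| ≤ C * |ζ₁ - ζ₂| := by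
  obtain ⟨F, L, hL, hFL, hFc, hFB⟩ := trunc f hf (Z + T) (by positivity)
  obtain ⟨C, hC0, hC⟩ := fix_dep lam hlam m hL hFL hFc hT
  refine ⟨C, hC0, ?_⟩
  intro ζ₁ hζ₁ ζ₂ hζ₂ r hr
  obtain ⟨v₁, hv₁, H₁⟩ := sol_fix hm (h ζ₁ hζ₁) (Or.inl rfl) hT (mem_Ici.2 hT) hFc hFB
    (by linarith [hJ ζ₁ hζ₁])
  obtain ⟨v₂, hv₂, H₂⟩ := sol_fix hm (h ζ₂ hζ₂) (Or.inl rfl) hT (mem_Ici.2 hT) hFc hFB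
    (by linarith [hJ ζ₂ hζ₂])
  have := hC ζ₁ ζ₂ v₁ v₂ hv₁ hv₂ (fun s hs => (H₁ s hs).2.2.1) (fun s hs => (H₂ s hs).2.2.1) r hr
  rw [(H₁ r hr).1, (H₂ r hr).1, ← (H₁ r hr).2.2.2, ← (H₂ r hr).2.2.2] at this
  exact this

lemma neg_start {m : ℕ} (hm : 1 ≤ m) {lam : ℝ} (hlam : 0 < lam) {f : ℝ → ℝ} (hf : LocallyLipschitz f)
    {ζ : ℝ} {u u' : ℝ → ℝ} (h : IsRadialSol (m + 1) lam f ζ (Ici 0) u u') {δ : ℝ}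
    (hpos : ∀ x, |x - ζ| ≤ δ → 0 < f x) {r : ℝ} (hr : r ∈ Ioc 0 δ) : ph (u' r) < 0 := by
  have hr0 := hr.1
  obtain ⟨F, L, hL, hFL, hFc, hFB⟩ := trunc f hf (|ζ| + r) (by positivity)
  obtain ⟨v, hv, H⟩ := sol_fix hm h (Or.inl rfl) hr0.le (mem_Ici.2 hr0.le) hFc hFB le_rfl
  rw [(H r (right_mem_Icc.2 hr0.le)).2.2.2, WW]
  have := GG_pos m (hFc.comp hv) hr0.le (fun t ht => by
    simp only [Function.comp]
    rw [(H t ht).2.1]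
    apply hpos
    exact (sol_lip h (Or.inl rfl) ht.1 ht.1).trans (ht.2.trans hr.2))
  have : 0 < lam * (r * GG m (F ∘ v) r) := by positivity
  linarith

/-- a solution cannot reach an equilibrium in finite time -/
lemma touch {m : ℕ} {lam : ℝ} (hlam : 0 ≤ lam) {f : ℝ → ℝ} (hf : LocallyLipschitz f)
    {ζ : ℝ} {u u' : ℝ → ℝ} (h : IsRadialSol (m + 1) lam f ζ (Ici 0) u u') {R : ℝ} (hR : 0 < R)
    (hfc : f (u R) = 0) (hw : u' R = 0) : ∀ r ∈ Icc (R / 2) R, u r = u R ∧ ph (u' r) = 0 := by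
  have hlip : ∀ r, 0 ≤ r → |u r - ζ| ≤ r := fun r hr => sol_lip h (Or.inl rfl) hr hr
  obtain ⟨F, L, hL, hFL, hFc, hFB⟩ := trunc f hf (|ζ| + R) (by positivity)
  have hwc := sol_phi_cont h (Or.inl rfl)
  obtain ⟨h1, h2, h3, h4, h5, h6⟩ := h
  set c := u R with hc
  have hFv : ∀ r ∈ Icc 0 R, F (u r) = f (u r) := by
    intro r hr
    apply hFB
    have h7 := hlip r hr.1
    have h8 := hr.2
    have : |u r| ≤ |u r - ζ| + |ζ| := by
      have := abs_add_le (u r - ζ) ζ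
      simpa using this
    linarith
  set K : ℝ := 1 + 2 * (m * (2 / R)) + lam * L with hK
  let q : ℝ → ℝ := fun r => ((u r - c) ^ 2 + ph (u' r) ^ 2) * Real.exp (K * r)
  have hsub : Icc (R / 2) R ⊆ Ici 0 := fun x hx => by
    have := hx.1
    simp only [mem_Ici]; linarith
  have hmono : MonotoneOn q (Icc (R / 2) R) := by
    apply monotoneOn_of_hasDerivWithinAt_nonneg (convex_Icc _ _)
      (f' := fun x => (2 * (u x - c) * u' x + 2 * ph (u' x) * (-((m : ℝ) / x * ph (u' x) + lam * f (u x)))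
        + K * ((u x - c) ^ 2 + ph (u' x) ^ 2)) * Real.exp (K * x))
    · have ha := hwc.mono hsub
      have hb := h1.continuousOn.mono hsub
      simp only [q]
      fun_prop
    · intro x hx
      rw [interior_Icc] at hx
      have hx0 : 0 < x := by linarith [hx.1]
      have hn : Ici 0 ∈ nhds x := Ici_mem_nhds hx0
      have d1 := (h2 x hx0.le).hasDerivAt hn
      have d2 := (h6 x hx0.le hx0).hasDerivAt hn
      have d3 := (((d1.sub_const c).pow 2).add (d2.pow 2)).mul ((hasDerivAt_id x).const_mul K).exp
      refine HasDerivAt.hasDerivWithinAt ?_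
      refine HasDerivAt.congr_deriv d3 ?_
      simp only [id_eq, Pi.add_apply, Pi.pow_apply]
      unfold ph
      push_cast
      ring
    · intro x hx
      rw [interior_Icc] at hx
      have hx0 : 0 < x := by linarith [hx.1]
      refine mul_nonneg ?_ (Real.exp_pos _).le
      have hp : |u' x| ≤ |ph (u' x)| := by
        have := psi_phi (u' x) (h5 x hx0.le)
        have h0 : |psi (ph (u' x)) - psi 0| ≤ |ph (u' x) - 0| := psi_lip _ _
        unfold ph at h0 ⊢
        rw [this] at h0
        simpa [psi] using h0
      have hff : |f (u x)| ≤ L * |u x - c| := by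
        have := hFL (u x) c
        rwa [hFv x ⟨hx0.le, hx.2.le⟩, hFv R (right_mem_Icc.2 hR.le), hfc, sub_zero] at this
      set a := u x - c
      set b := ph (u' x)
      have e1 : -(a ^ 2 + b ^ 2) ≤ 2 * a * u' x := by
        have : -(|a| * |b|) ≤ a * u' x := by
          have h9 : |a * u' x| ≤ |a| * |b| := by rw [abs_mul]; gcongr
          linarith [neg_abs_le (a * u' x)]
        nlinarith [sq_nonneg (|a| - |b|), sq_abs a, sq_abs b]
      have e2 : lam * (b * f (u x)) ≤ lam * (L * (|a| * |b|)) := by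
        apply mul_le_mul_of_nonneg_left _ hlam
        calc b * f (u x) ≤ |b * f (u x)| := le_abs_self _
          _ = |b| * |f (u x)| := abs_mul _ _
          _ ≤ |b| * (L * |a|) := by gcongr
          _ = _ := by ring
      have e2' : lam * (L * (2 * (|a| * |b|))) ≤ lam * (L * (a ^ 2 + b ^ 2)) := by
        gcongr
        nlinarith [sq_nonneg (|a| - |b|), sq_abs a, sq_abs b]
      have e3 : (m : ℝ) / x * b ^ 2 ≤ m * (2 / R) * b ^ 2 := by
        rw [div_eq_mul_inv]
        have : x⁻¹ ≤ 2 / R := by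
          rw [inv_le_comm₀ hx0 (by positivity), inv_div]; exact hx.1.le
        gcongr
      have e4 : 0 ≤ m * (2 / R) * a ^ 2 := by positivity
      rw [hK]
      nlinarith
  intro r hr
  have hq := hmono hr (right_mem_Icc.2 (by linarith)) hr.2
  simp only [q, ← hc, hw] at hq
  simp only [sub_self, ph, zero_div] at hq
  have hq2 : (u r - c) ^ 2 + ph (u' r) ^ 2 ≤ 0 := by
    have := Real.exp_pos (K * r)
    by_contra hcon
    push Not at hcon
    have := mul_pos hcon this
    unfold ph at this
    norm_num at hq
    linarith
  constructor
  · have : (u r - c) ^ 2 = 0 := by nlinarith [sq_nonneg (u r - c), sq_nonneg (ph (u' r))]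
    exact sub_eq_zero.1 (pow_eq_zero_iff (two_ne_zero)|>.1 this)
  · have : ph (u' r) ^ 2 = 0 := by nlinarith [sq_nonneg (u r - c), sq_nonneg (ph (u' r))]
    exact pow_eq_zero_iff (two_ne_zero)|>.1 this

lemma u'_eq {N : ℕ} {lam : ℝ} {f : ℝ → ℝ} {ζ : ℝ} {u u' : ℝ → ℝ}
    (h : IsRadialSol N lam f ζ (Ici 0) u u') {r : ℝ} (hr : 0 ≤ r) : psi (ph (u' r)) = u' r :=
  psi_phi _ (h.2.2.2.2.1 r hr)

lemma u'_neg_iff {N : ℕ} {lam : ℝ} {f : ℝ → ℝ} {ζ : ℝ} {u u' : ℝ → ℝ}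
    (h : IsRadialSol N lam f ζ (Ici 0) u u') {r : ℝ} (hr : 0 ≤ r) : u' r < 0 ↔ ph (u' r) < 0 := by
  rw [← psi_neg_iff (ph (u' r)), u'_eq h hr]

lemma u'_zero_iff {N : ℕ} {lam : ℝ} {f : ℝ → ℝ} {ζ : ℝ} {u u' : ℝ → ℝ}
    (h : IsRadialSol N lam f ζ (Ici 0) u u') {r : ℝ} (hr : 0 ≤ r) : u' r = 0 ↔ ph (u' r) = 0 := by
  rw [← psi_eq_zero_iff (ph (u' r)), u'_eq h hr]

lemma notouch {m : ℕ} {lam : ℝ} (hlam : 0 ≤ lam) {f : ℝ → ℝ} (hf : LocallyLipschitz f)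
    {ζ : ℝ} {u u' : ℝ → ℝ} (h : IsRadialSol (m + 1) lam f ζ (Ici 0) u u') {R : ℝ} (hR : 0 < R)
    (hneg : ∀ r ∈ Ioo 0 R, u' r < 0) (hw : u' R = 0) : f (u R) ≠ 0 := by
  intro hfc
  have h1 := (touch hlam hf h hR hfc hw (3 * R / 4) ⟨by linarith, by linarith⟩).2
  have h2 := hneg (3 * R / 4) ⟨by linarith, by linarith⟩
  rw [u'_neg_iff h (by linarith), h1] at h2
  exact lt_irrefl _ h2

lemma sol_anti {N : ℕ} {lam : ℝ} {f : ℝ → ℝ} {ζ : ℝ} {u u' : ℝ → ℝ}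
    (h : IsRadialSol N lam f ζ (Ici 0) u u') {b : ℝ}
    (hneg : ∀ r ∈ Ioo 0 b, u' r < 0) : StrictAntiOn u (Icc 0 b) := by
  apply strictAntiOn_of_deriv_neg (convex_Icc 0 b)
  · exact h.1.continuousOn.mono (fun x hx => hx.1)
  · intro x hx
    rw [interior_Icc] at hx
    rw [((h.2.1 x hx.1.le).hasDerivAt (Ici_mem_nhds hx.1)).deriv]
    exact hneg x hx

lemma slope_sign {g : ℝ → ℝ} {d R : ℝ} (hg : HasDerivAt g d R) (h0 : g R = 0) (hd : 0 < d) :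
    ∀ᶠ x in nhdsWithin R {R}ᶜ, 0 < g x / (x - R) := by
  rw [hasDerivAt_iff_tendsto_slope] at hg
  filter_upwards [hg.eventually (lt_mem_nhds hd)] with x hx
  rwa [slope_def_field, h0, sub_zero] at hx

lemma ph_deriv {m : ℕ} {lam : ℝ} {f : ℝ → ℝ}
    {ζ : ℝ} {u u' : ℝ → ℝ} (h : IsRadialSol (m + 1) lam f ζ (Ici 0) u u') {R : ℝ} (hR : 0 < R)
    (hw : u' R = 0) : HasDerivAt (fun r => ph (u' r)) (-(lam * f (u R))) R := by
  have := (h.2.2.2.2.2 R hR.le hR).hasDerivAt (Ici_mem_nhds hR)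
  refine HasDerivAt.congr_deriv this ?_
  simp [hw]

lemma exists_right {m : ℕ} {lam : ℝ} (hlam : 0 < lam) {f : ℝ → ℝ} (hf : LocallyLipschitz f)
    {ζ : ℝ} {u u' : ℝ → ℝ} (h : IsRadialSol (m + 1) lam f ζ (Ici 0) u u') {R : ℝ} (hR : 0 < R)
    (hneg : ∀ r ∈ Ioo 0 R, u' r < 0) (hw : u' R = 0) (hu : 0 < u R) :
    ∃ R₂ > R, 0 < ph (u' R₂) ∧ ∀ r ∈ Icc R R₂, 0 < u r := by
  have hd := ph_deriv h hR hw
  have hp0 : ph (u' R) = 0 := by simp [hw, ph]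
  rcases lt_trichotomy (f (u R)) 0 with hlt | heq | hgt
  · have h1 := slope_sign hd hp0 (by nlinarith)
    have h1' := h1.filter_mono (nhdsWithin_mono R (show Ioi R ⊆ {R}ᶜ from fun x hx => ne_of_gt hx))
    have hc : ContinuousAt u R := ((h.2.1 R hR.le).hasDerivAt (Ici_mem_nhds hR)).continuousAt
    obtain ⟨η, hη, hball⟩ := Metric.eventually_nhds_iff.1 (hc.eventually (lt_mem_nhds hu))
    obtain ⟨x, hx, hxm⟩ := (h1'.and (Ioo_mem_nhdsGT (show R < R + η by linarith))).exists
    refine ⟨x, hxm.1, ?_, ?_⟩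
    · rwa [lt_div_iff₀ (by linarith [hxm.1]), zero_mul] at hx
    · intro r hr
      apply hball
      rw [Real.dist_eq, abs_of_nonneg (by linarith [hr.1])]
      linarith [hr.2, hxm.2]
  · exact absurd heq (notouch hlam.le hf h hR hneg hw)
  · exfalso
    have h1 := slope_sign hd.neg (by simp [hp0]) (by have := mul_pos hlam hgt; linarith)
    have h1' := h1.filter_mono (nhdsWithin_mono R (show Iio R ⊆ {R}ᶜ from fun x hx => ne_of_lt hx))
    obtain ⟨x, hx, hxm⟩ := (h1'.and (Ioo_mem_nhdsLT hR)).exists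
    have h3 := (u'_neg_iff h hxm.1.le).1 (hneg x hxm)
    have : -ph (u' x) / (x - R) < 0 := div_neg_of_pos_of_neg (by linarith) (by linarith [hxm.2])
    exact lt_asymm hx this

theorem main_aux (m : ℕ) (hm : 1 ≤ m) (lam : ℝ) (hlam : 0 < lam) (f : ℝ → ℝ) (a b : ℝ) (ha : 0 < a)
    (hf0 : ∀ s ≤ (0:ℝ), f s = 0) (hf : LocallyLipschitz f) (hpos : ∀ s ∈ Ioo a b, 0 < f s)
    (U U' : ℝ → ℝ → ℝ)
    (hS : ∀ ζ ∈ Ioo a b, IsRadialSol (m + 1) lam f ζ (Ici 0) (U ζ) (U' ζ)) :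
    Disjoint
      {ζ | ζ ∈ Ioo a b ∧ ∃ R' > (0:ℝ),
        (∀ r ∈ Ioo (0:ℝ) R', 0 < U ζ r ∧ U' ζ r < 0) ∧ U' ζ R' = 0}
      {ζ | ζ ∈ Ioo a b ∧ ∃ R' > (0:ℝ),
        (∀ r ∈ Ioo (0:ℝ) R', 0 < U ζ r ∧ U' ζ r < 0) ∧ U ζ R' = 0} ∧
    IsOpen
      {ζ | ζ ∈ Ioo a b ∧ ∃ R' > (0:ℝ),
        (∀ r ∈ Ioo (0:ℝ) R', 0 < U ζ r ∧ U' ζ r < 0) ∧ U' ζ R' = 0} ∧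
    IsOpen
      {ζ | ζ ∈ Ioo a b ∧ ∃ R' > (0:ℝ),
        (∀ r ∈ Ioo (0:ℝ) R', 0 < U ζ r ∧ U' ζ r < 0) ∧ U ζ R' = 0} := by
  have hstart : ∀ ζ₀ ∈ Ioo a b, ∃ δ > 0, ∃ ε > 0, ∀ ζ, |ζ - ζ₀| < ε → ζ ∈ Ioo a b ∧
      ∀ r ∈ Ioc 0 δ, ph (U' ζ r) < 0 := by
    intro ζ₀ hζ₀
    obtain ⟨η, hη, hball⟩ := Metric.isOpen_iff.1 isOpen_Ioo ζ₀ hζ₀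
    refine ⟨η / 4, by positivity, η / 2, by positivity, fun ζ hζ => ?_⟩
    have hm1 : ζ ∈ Ioo a b := hball (by rw [Metric.mem_ball, Real.dist_eq]; linarith)
    refine ⟨hm1, fun r hr => neg_start hm hlam hf (hS ζ hm1) (fun x hx => ?_) hr⟩
    apply hpos
    apply hball
    rw [Metric.mem_ball, Real.dist_eq]
    have := abs_sub_le x ζ ζ₀
    linarith
  have hdep : ∀ T : ℝ, 0 ≤ T → ∀ ζ₀ ∈ Ioo a b, ∀ c > 0, ∃ ε > 0, ∀ ζ ∈ Ioo a b, |ζ - ζ₀| < ε →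
      ∀ r ∈ Icc 0 T, |U ζ r - U ζ₀ r| < c ∧ |ph (U' ζ r) - ph (U' ζ₀ r)| < c := by
    intro T hT ζ₀ hζ₀ c hc
    obtain ⟨C, hC0, hC⟩ := sol_dep hm hlam.le hf (J := Ioo a b) (Z := |b|)
      (fun ζ hζ => by
        rw [abs_of_pos (ha.trans hζ.1)]
        exact hζ.2.le.trans (le_abs_self b)) (abs_nonneg b) hS hT
    refine ⟨c / (C + 1), by positivity, fun ζ hζ hd r hr => ?_⟩
    rw [lt_div_iff₀ (by positivity)] at hd
    have := hC ζ hζ ζ₀ hζ₀ r hr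
    have h0 := abs_nonneg (ζ - ζ₀)
    constructor
    · by_cases hz : |ζ - ζ₀| = 0
      · rw [hz, mul_zero] at this; linarith
      · have : 0 < |ζ - ζ₀| := lt_of_le_of_ne h0 (Ne.symm hz)
        nlinarith
    · by_cases hz : |ζ - ζ₀| = 0
      · rw [hz, mul_zero] at this; linarith
      · have : 0 < |ζ - ζ₀| := lt_of_le_of_ne h0 (Ne.symm hz)
        nlinarith
  have hUc : ∀ ζ ∈ Ioo a b, ContinuousOn (U ζ) (Ici 0) := fun ζ hζ => (hS ζ hζ).1.continuousOn
  have hPc : ∀ ζ ∈ Ioo a b, ContinuousOn (fun r => ph (U' ζ r)) (Ici 0) :=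
    fun ζ hζ => sol_phi_cont (hS ζ hζ) (Or.inl rfl)
  have hsubI : ∀ {x y : ℝ}, 0 ≤ x → Icc x y ⊆ Ici 0 := fun hx z hz => hx.trans hz.1
  refine ⟨?_, ?_, ?_⟩
  · rw [Set.disjoint_left]
    rintro ζ ⟨hζ, R₁, hR₁, h₁, e₁⟩ ⟨-, R₂, hR₂, h₂, e₂⟩
    rcases lt_trichotomy R₁ R₂ with hlt | heq | hgt
    · have := (h₂ R₁ ⟨hR₁, hlt⟩).2
      linarith
    · subst heq
      refine notouch hlam.le hf (hS ζ hζ) hR₁ (fun r hr => (h₁ r hr).2) e₁ ?_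
      rw [e₂]; exact hf0 0 le_rfl
    · have := (h₁ R₂ ⟨hR₂, hgt⟩).1
      linarith
  · rw [Metric.isOpen_iff]
    rintro ζ₀ ⟨hζ₀, R, hR, h₁, e₁⟩
    have hsol₀ := hS ζ₀ hζ₀
    have hneg : ∀ r ∈ Ioo 0 R, U' ζ₀ r < 0 := fun r hr => (h₁ r hr).2
    have huR : 0 < U ζ₀ R := by
      by_contra hcon
      exact notouch hlam.le hf hsol₀ hR hneg e₁ (hf0 _ (not_lt.1 hcon))
    obtain ⟨R₂, hRR, hp2, hu2⟩ := exists_right hlam hf hsol₀ hR hneg e₁ huR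
    have hupos : ∀ r ∈ Icc 0 R₂, 0 < U ζ₀ r := by
      intro r hr
      rcases lt_or_ge r R with hlt | hge
      · rcases hr.1.eq_or_lt with rfl | h0
        · rw [hsol₀.2.2.1]; exact ha.trans hζ₀.1
        · exact (h₁ r ⟨h0, hlt⟩).1
      · exact hu2 r ⟨hge, hr.2⟩
    have hR20 : 0 ≤ R₂ := by linarith
    obtain ⟨x, hx, hmin⟩ := isCompact_Icc.exists_isMinOn (nonempty_Icc.2 hR20)
      ((hUc ζ₀ hζ₀).mono (hsubI le_rfl))
    obtain ⟨δ, hδ, ε₁, hε₁, H₁⟩ := hstart ζ₀ hζ₀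
    obtain ⟨ε₂, hε₂, H₂⟩ := hdep R₂ hR20 ζ₀ hζ₀ (min (U ζ₀ x) (ph (U' ζ₀ R₂)))
      (lt_min (hupos x hx) hp2)
    refine ⟨min ε₁ ε₂, lt_min hε₁ hε₂, fun ζ hζ => ?_⟩
    rw [Metric.mem_ball, Real.dist_eq, lt_min_iff] at hζ
    obtain ⟨hζJ, hζn⟩ := H₁ ζ hζ.1
    have hd := H₂ ζ hζJ hζ.2
    have hUp : ∀ r ∈ Icc 0 R₂, 0 < U ζ r := by
      intro r hr
      have h3 := (hd r hr).1.trans_le (min_le_left _ _)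
      have h4 : U ζ₀ x ≤ U ζ₀ r := hmin hr
      linarith [(abs_lt.1 h3).1]
    have hPp : 0 < ph (U' ζ R₂) := by
      have h3 := (hd R₂ (right_mem_Icc.2 hR20)).2.trans_le (min_le_right _ _)
      linarith [(abs_lt.1 h3).1]
    set δ' := min δ R with hδ'
    have hδ'0 : 0 < δ' := lt_min hδ hR
    have hδ'R : δ' < R₂ := (min_le_right _ _).trans_lt hRR
    have hPδ : ph (U' ζ δ') < 0 := hζn δ' ⟨hδ'0, min_le_left _ _⟩
    have hcomp : IsCompact (Icc δ' R₂ ∩ (fun r => ph (U' ζ r)) ⁻¹' {0}) :=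
      isCompact_Icc.of_isClosed_subset
        (((hPc ζ hζJ).mono (hsubI hδ'0.le)).preimage_isClosed_of_isClosed isClosed_Icc
          isClosed_singleton) inter_subset_left
    have hne : (Icc δ' R₂ ∩ (fun r => ph (U' ζ r)) ⁻¹' {0}).Nonempty := by
      obtain ⟨y, hy, hy0⟩ := intermediate_value_Icc hδ'R.le
        ((hPc ζ hζJ).mono (hsubI hδ'0.le)) ⟨hPδ.le, hPp.le⟩
      exact ⟨y, hy, hy0⟩
    obtain ⟨r₀, ⟨hr₀, hr₀z⟩, hleast⟩ := hcomp.exists_isLeast hne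
    have hr₀p : 0 < r₀ := hδ'0.trans_le hr₀.1
    refine ⟨hζJ, r₀, hr₀p, fun r hr => ⟨hUp r ⟨hr.1.le, hr.2.le.trans hr₀.2⟩, ?_⟩,
      (u'_zero_iff (hS ζ hζJ) hr₀p.le).2 hr₀z⟩
    rw [u'_neg_iff (hS ζ hζJ) hr.1.le]
    rcases le_or_gt r δ' with hle | hgt
    · exact hζn r ⟨hr.1, hle.trans (min_le_left _ _)⟩
    · by_contra hcon
      obtain ⟨y, hy, hy0⟩ := intermediate_value_Icc hgt.le
        ((hPc ζ hζJ).mono (hsubI hδ'0.le)) ⟨hPδ.le, not_lt.1 hcon⟩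
      have : r₀ ≤ y := hleast ⟨⟨hy.1, hy.2.trans (hr.2.le.trans hr₀.2)⟩, hy0⟩
      linarith [hy.2, hr.2]
  · rw [Metric.isOpen_iff]
    rintro ζ₀ ⟨hζ₀, R, hR, h₁, e₁⟩
    have hsol₀ := hS ζ₀ hζ₀
    have hneg : ∀ r ∈ Ioo 0 R, U' ζ₀ r < 0 := fun r hr => (h₁ r hr).2
    have hPat : ContinuousAt (fun r => ph (U' ζ₀ r)) R := (hPc ζ₀ hζ₀).continuousAt (Ici_mem_nhds hR)
    have hPle : ph (U' ζ₀ R) ≤ 0 := by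
      refine le_of_tendsto (hPat.tendsto.mono_left (nhdsWithin_le_nhds (s := Iio R))) ?_
      filter_upwards [Ioo_mem_nhdsLT hR] with r hr
      exact ((u'_neg_iff hsol₀ hr.1.le).1 (hneg r hr)).le
    have hPR : ph (U' ζ₀ R) < 0 := by
      refine lt_of_le_of_ne hPle fun hz => ?_
      refine notouch hlam.le hf hsol₀ hR hneg ((u'_zero_iff hsol₀ hR.le).2 hz) ?_
      rw [e₁]; exact hf0 0 le_rfl
    obtain ⟨η, hη, hball⟩ := Metric.eventually_nhds_iff.1 (hPat.eventually (gt_mem_nhds hPR))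
    set R₂ := R + η / 2 with hR₂
    have hRR : R < R₂ := by linarith
    have hPneg : ∀ r ∈ Ioc 0 R₂, ph (U' ζ₀ r) < 0 := by
      intro r hr
      rcases lt_or_ge r R with hlt | hge
      · exact (u'_neg_iff hsol₀ hr.1.le).1 (hneg r ⟨hr.1, hlt⟩)
      · apply hball
        rw [Real.dist_eq, abs_of_nonneg (by linarith)]
        linarith [hr.2]
    have hR20 : 0 ≤ R₂ := by linarith
    have hU2 : U ζ₀ R₂ < 0 := by
      rw [← e₁]
      exact sol_anti hsol₀ (b := R₂) (fun r hr => (u'_neg_iff hsol₀ hr.1.le).2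
        (hPneg r ⟨hr.1, hr.2.le⟩)) ⟨hR.le, hRR.le⟩ (right_mem_Icc.2 hR20) hRR
    obtain ⟨δ, hδ, ε₁, hε₁, H₁⟩ := hstart ζ₀ hζ₀
    set δ' := min δ R with hδ'
    have hδ'0 : 0 < δ' := lt_min hδ hR
    have hδ'R : δ' < R₂ := (min_le_right _ _).trans_lt hRR
    obtain ⟨x, hx, hmax⟩ := isCompact_Icc.exists_isMaxOn (nonempty_Icc.2 hδ'R.le)
      ((hPc ζ₀ hζ₀).mono (hsubI hδ'0.le))
    have hxn := hPneg x ⟨hδ'0.trans_le hx.1, hx.2⟩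
    obtain ⟨ε₂, hε₂, H₂⟩ := hdep R₂ hR20 ζ₀ hζ₀ (min (-U ζ₀ R₂) (-ph (U' ζ₀ x)))
      (lt_min (by linarith) (by linarith))
    refine ⟨min ε₁ ε₂, lt_min hε₁ hε₂, fun ζ hζ => ?_⟩
    rw [Metric.mem_ball, Real.dist_eq, lt_min_iff] at hζ
    obtain ⟨hζJ, hζn⟩ := H₁ ζ hζ.1
    have hd := H₂ ζ hζJ hζ.2
    have hsol := hS ζ hζJ
    have hUn : U ζ R₂ < 0 := by
      have h3 := (hd R₂ (right_mem_Icc.2 hR20)).1.trans_le (min_le_left _ _)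
      linarith [(abs_lt.1 h3).2]
    have hPn : ∀ r ∈ Ioc 0 R₂, U' ζ r < 0 := by
      intro r hr
      rw [u'_neg_iff hsol hr.1.le]
      rcases le_or_gt r δ' with hle | hgt
      · exact hζn r ⟨hr.1, hle.trans (min_le_left _ _)⟩
      · have h3 := (hd r ⟨hr.1.le, hr.2⟩).2.trans_le (min_le_right _ _)
        have h4 : ph (U' ζ₀ r) ≤ ph (U' ζ₀ x) := hmax ⟨hgt.le, hr.2⟩
        linarith [(abs_lt.1 h3).2]
    have hanti : StrictAntiOn (U ζ) (Icc 0 R₂) :=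
      sol_anti hsol (fun r hr => hPn r ⟨hr.1, hr.2.le⟩)
    have hU0 : 0 < U ζ 0 := by rw [hsol.2.2.1]; exact ha.trans hζJ.1
    obtain ⟨y, hy, hy0⟩ := intermediate_value_Icc' hR20
        ((hUc ζ hζJ).mono (hsubI le_rfl)) ⟨hUn.le, hU0.le⟩
    have hyp : 0 < y := by
      refine lt_of_le_of_ne hy.1 fun h => ?_
      rw [← h] at hy0
      linarith
    refine ⟨hζJ, y, hyp, fun r hr => ⟨?_, hPn r ⟨hr.1, hr.2.le.trans hy.2⟩⟩, hy0⟩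
    rw [← hy0]
    exact hanti ⟨hr.1.le, hr.2.le.trans hy.2⟩ hy hr.2

/-- Lemma 2.7: the sets `I_k⁺` and `I_k⁻` of shooting data are disjoint and
open. Here `U ζ` (with derivative `U' ζ` and domain `Dom ζ`) is the maximally extended
solution of the IVP with initial value `ζ`. -/
theorem lemma27_Ik_open_disjoint
    (N : ℕ) (hN : 2 ≤ N) (lam : ℝ) (hlam : 0 < lam)
    (n : ℕ) (f : ℝ → ℝ) (α β : ℕ → ℝ)
    (hf0 : ∀ s ≤ (0:ℝ), f s = 0)
    (hfLip : LocallyLipschitz f)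
    (hf00 : f 0 = 0)
    (hβ0 : β 0 = 0)
    (horder : ∀ i, 1 ≤ i → i ≤ n → β (i - 1) < α i ∧ α i < β i)
    (hA2neg : ∀ i, 1 ≤ i → i ≤ n → ∀ s ∈ Set.Ioo (β (i - 1)) (α i), f s < 0)
    (hA2pos : ∀ i, 1 ≤ i → i ≤ n → ∀ s ∈ Set.Ioo (α i) (β i), 0 < f s)
    (k : ℕ) (hk1 : 1 ≤ k) (hkn : k ≤ n)
    (U U' : ℝ → ℝ → ℝ) (Dom : ℝ → Set ℝ)
    (hsol : ∀ ζ ∈ Set.Ioo (α k) (β k),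
      IsSolDomain (Dom ζ) ∧ IsRadialSol N lam f ζ (Dom ζ) (U ζ) (U' ζ) ∧
      -- maximality of the extension
      (∀ (E : Set ℝ) (v v' : ℝ → ℝ), IsSolDomain E → Dom ζ ⊆ E → Dom ζ ≠ E →
        IsRadialSol N lam f ζ E v v' → ¬(∀ r ∈ Dom ζ, v r = U ζ r))) :
    Disjoint
      {ζ | ζ ∈ Set.Ioo (α k) (β k) ∧ ∃ R' > (0:ℝ), R' ∈ Dom ζ ∧
        (∀ r ∈ Set.Ioo (0:ℝ) R', 0 < U ζ r ∧ U' ζ r < 0) ∧ U' ζ R' = 0}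
      {ζ | ζ ∈ Set.Ioo (α k) (β k) ∧ ∃ R' > (0:ℝ), R' ∈ Dom ζ ∧
        (∀ r ∈ Set.Ioo (0:ℝ) R', 0 < U ζ r ∧ U' ζ r < 0) ∧ U ζ R' = 0} ∧
    IsOpen
      {ζ | ζ ∈ Set.Ioo (α k) (β k) ∧ ∃ R' > (0:ℝ), R' ∈ Dom ζ ∧
        (∀ r ∈ Set.Ioo (0:ℝ) R', 0 < U ζ r ∧ U' ζ r < 0) ∧ U' ζ R' = 0} ∧
    IsOpen
      {ζ | ζ ∈ Set.Ioo (α k) (β k) ∧ ∃ R' > (0:ℝ), R' ∈ Dom ζ ∧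
        (∀ r ∈ Set.Ioo (0:ℝ) R', 0 < U ζ r ∧ U' ζ r < 0) ∧ U ζ R' = 0} := by
  obtain ⟨m, rfl⟩ : ∃ m, N = m + 1 := ⟨N - 1, by omega⟩
  have hβ : ∀ i, i ≤ n → 0 ≤ β i := by
    intro i
    induction i with
    | zero => intro _; rw [hβ0]
    | succ i ih =>
      intro hi
      have h1 := horder (i + 1) (by omega) hi
      have h2 := ih (by omega)
      simp only [Nat.add_sub_cancel] at h1
      linarith [h1.1, h1.2]
  have ha : 0 < α k := by
    have h1 := horder k hk1 hkn
    have h2 := hβ (k - 1) (by omega)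
    linarith [h1.1]
  have hDom : ∀ ζ ∈ Set.Ioo (α k) (β k), Dom ζ = Ici 0 := fun ζ hζ =>
    dom_eq (by omega) hlam.le hfLip (hsol ζ hζ).1 (hsol ζ hζ).2.1 (hsol ζ hζ).2.2
  have hmain := main_aux m (by omega) lam hlam f (α k) (β k) ha hf0 hfLip (hA2pos k hk1 hkn) U U'
    (fun ζ hζ => by
      have := (hsol ζ hζ).2.1
      rwa [hDom ζ hζ] at this)
  have key : ∀ P : ℝ → ℝ → Prop,
      {ζ | ζ ∈ Set.Ioo (α k) (β k) ∧ ∃ R' > (0:ℝ), R' ∈ Dom ζ ∧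
        (∀ r ∈ Set.Ioo (0:ℝ) R', 0 < U ζ r ∧ U' ζ r < 0) ∧ P ζ R'} =
      {ζ | ζ ∈ Set.Ioo (α k) (β k) ∧ ∃ R' > (0:ℝ),
        (∀ r ∈ Set.Ioo (0:ℝ) R', 0 < U ζ r ∧ U' ζ r < 0) ∧ P ζ R'} := by
    intro P
    ext ζ
    constructor
    · rintro ⟨hζ, R, hR, -, h⟩
      exact ⟨hζ, R, hR, h⟩
    · rintro ⟨hζ, R, hR, h⟩
      refine ⟨hζ, R, hR, ?_, h⟩
      rw [hDom ζ hζ]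
      exact hR.le
  rw [key (fun ζ R' => U' ζ R' = 0), key (fun ζ R' => U ζ R' = 0)]
  exact hmain
end
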